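/- arXiv:1905.07351 — 4 statements merged into one kernel-verified Lean document; each statement's English description precedes it below -/
import Mathlib

section
/- Let α ∈ (0,1), N ∈ ℕ, T > 0, let a₁,…,a_N > 0, and let x₁⁰,…,x_N⁰ ∈ ℝ² be pairwise distinct. Let C₁, C₂, d > 0 be constants. Suppose that for each ε ∈ (0,1] we are given functions θ_{1,ε}⁰,…,θ_{N,ε}⁰ ∈ C_c^∞(ℝ²) such that: (i) supp(θ_{i,ε}⁰) ⊂ B(x_i⁰, C₁ε) for each i, and the supports of θ_{i,ε}⁰ and θ_{j,ε}⁰ are at distance ≥ d for i ≠ j; (ii) ∫_{ℝ²} θ_{i,ε}⁰ = a_i for each i; (iii) 0 ≤ θ_{i,ε}⁰ ≤ C₂ ε^{−2}. Suppose further that for each ε ∈ (0,1] there is a continuously differentiable function θ_ε : [0,T] × ℝ² → ℝ such that θ_ε(0,·) = Σ_{i=1}^N θ_{i,ε}⁰, θ_ε(t,·) has compact support for each t, θ_ε ≥ 0, ∫_{ℝ²} θ_ε(t,x) dx = Σ_{i=1}^N a_i and 0 ≤ θ_ε(t,x) ≤ C₂ε^{−2} for all (t,x), and ∂_t θ_ε(t,x)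 + u_ε(t,x) · ∇_x θ_ε(t,x) = 0 for all (t,x), where u_ε(t,x) = ∫_{ℝ²} K_α(x − y) θ_ε(t,y) dy. Let x = (x₁,…,x_N) be a solution of the α-point-vortex model on [0,T] with intensities (a₁,…,a_N) and initial configuration (x₁⁰,…,x_N⁰). Then for every bounded continuous function f : ℝ² → ℝ, sup_{t ∈ [0,T]} |∫_{ℝ²} θ_ε(t,x) f(x) dx − Σ_{i=1}^N a_i f(x_i(t))| → 0 as ε → 0⁺. -/
open MeasureTheory Finset
noncomputable section

abbrev E2 : Type := EuclideanSpace ℝ (Fin 2)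

def perp (z : E2) : E2 := !₂[-(z 1), z 0]

def Cconst (α : ℝ) : ℝ :=
  Real.Gamma (α / 2) / (2 ^ ((2:ℝ) - α) * Real.pi * Real.Gamma ((2 - α) / 2))

def K (α : ℝ) (z : E2) : E2 := (-(α * Cconst α) / ‖z‖ ^ (α + 2)) • perp z

def IsPVSol (α : ℝ) {N : ℕ} (a : Fin N → ℝ) (x0 : Fin N → E2) (T : ℝ)
    (x : ℝ → Fin N → E2) : Prop :=
  ContinuousOn x (Set.Icc 0 T) ∧
  (∀ t ∈ Set.Icc 0 T, ∀ i j : Fin N, i ≠ j → x t i ≠ x t j) ∧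
  (∀ i : Fin N, ∀ t ∈ Set.Icc 0 T,
    x t i = x0 i + ∑ j ∈ Finset.univ.erase i, a j • (∫ s in (0:ℝ)..t, K α (x s i - x s j)))

open scoped RealInnerProductSpace

lemma perp_norm (z : E2) : ‖perp z‖ = ‖z‖ := by
  simp [perp, EuclideanSpace.norm_eq, Fin.sum_univ_two, add_comm]

lemma perp_inner (z : E2) : ⟪z, perp z⟫ = 0 := by
  simp [perp, PiLp.inner_apply, Fin.sum_univ_two]; ring

lemma perp_neg (z : E2) : perp (-z) = - perp z := by
  ext i; fin_cases i <;> simp [perp]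

lemma perp_sub (z w : E2) : perp (z - w) = perp z - perp w := by
  ext i; fin_cases i <;> simp [perp]; ring

lemma perp_cont : Continuous perp := by
  unfold perp
  fun_prop

lemma K_neg (α : ℝ) (z : E2) : K α (-z) = - K α z := by
  simp [K, perp_neg]

lemma K_inner (α : ℝ) (z : E2) : ⟪z, K α z⟫ = 0 := by
  simp [K, inner_smul_right, perp_inner]

lemma K_norm (α : ℝ) (z : E2) : ‖K α z‖ ≤ |α * Cconst α| * ‖z‖ ^ (-(1 + α)) := by
  rcases eq_or_ne z 0 with rfl | hz
  · have : K α 0 = 0 := by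
      have : perp 0 = 0 := by ext i; fin_cases i <;> simp [perp]
      simp [K, this]
    rw [this, norm_zero]; positivity
  · have hz' : 0 < ‖z‖ := norm_pos_iff.2 hz
    rw [K, norm_smul, perp_norm, norm_div, norm_neg, Real.norm_eq_abs,
      Real.norm_of_nonneg (by positivity : 0 ≤ ‖z‖ ^ (α + 2)), div_mul_eq_mul_div, mul_div_assoc]
    apply le_of_eq
    congr 1
    rw [show -(1 + α) = 1 - (α + 2) by ring, Real.rpow_sub hz', Real.rpow_one]

lemma K_norm_le (α : ℝ) (hα : 0 < α) {m : ℝ} (hm : 0 < m) (z : E2) (hz : m ≤ ‖z‖) :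
    ‖K α z‖ ≤ |α * Cconst α| * m ^ (-(1 + α)) := by
  refine (K_norm α z).trans ?_
  gcongr ?_ * ?_
  exact Real.rpow_le_rpow_of_nonpos hm hz (by linarith)

lemma K_meas (α : ℝ) : Measurable (K α) := by
  unfold K
  have := perp_cont.measurable
  fun_prop

lemma K_contAt (α : ℝ) (z : E2) (hz : z ≠ 0) : ContinuousAt (K α) z := by
  unfold K
  have hz' : ‖z‖ ≠ 0 := norm_ne_zero_iff.2 hz
  refine ContinuousAt.smul (f := fun z : E2 => -(α * Cconst α) / ‖z‖ ^ (α + 2)) ?_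
    perp_cont.continuousAt
  refine ContinuousAt.div continuousAt_const ?_ ?_
  · exact ContinuousAt.rpow_const continuous_norm.continuousAt (Or.inl hz')
  · exact (Real.rpow_pos_of_pos (norm_pos_iff.2 hz) _).ne'

lemma finrank_E2 : Module.finrank ℝ E2 = 2 := by simp

lemma rpow_locInt (β : ℝ) (hβ : β < 2) :
    LocallyIntegrable (fun z : E2 => ‖z‖ ^ (-β)) volume := by
  refine locallyIntegrable_of_norm_le_rpow (C := 1) (α := β) (by simp) (by simpa using hβ) ?_ ?_
  · refine Filter.Eventually.of_forall fun x => ?_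
    rw [one_mul, Real.norm_of_nonneg (by positivity)]
  · exact (by fun_prop : Measurable (fun z : E2 => ‖z‖ ^ (-β))).aestronglyMeasurable

lemma K_locInt (α : ℝ) (hα1 : α < 1) : LocallyIntegrable (K α) volume :=
  locallyIntegrable_of_norm_le_rpow (C := |α * Cconst α|) (α := 1 + α) (by simp)
    (by simp; linarith) (Filter.Eventually.of_forall (K_norm α)) (K_meas α).aestronglyMeasurable

/-- Lipschitz bound away from the origin -/
lemma K_lip (α : ℝ) (hα : 0 < α) {m R : ℝ} (hm : 0 < m) :
    ∃ L : ℝ, 0 ≤ L ∧ ∀ z w : E2, m ≤ ‖z‖ → m ≤ ‖w‖ → ‖w‖ ≤ R →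
      ‖K α z - K α w‖ ≤ L * ‖z - w‖ := by
  set h : ℝ → ℝ := fun s => s ^ (-(α + 2)) with hh
  have hder : ∀ s ∈ Set.Ici m, HasDerivWithinAt h (-(α + 2) * s ^ (-(α + 2) - 1)) (Set.Ici m) s := by
    intro s hs
    exact (Real.hasDerivAt_rpow_const (Or.inl (hm.trans_le hs).ne')).hasDerivWithinAt
  have hb : ∀ s ∈ Set.Ici m, ‖-(α + 2) * s ^ (-(α + 2) - 1)‖ ≤ (α + 2) * m ^ (-(α + 2) - 1) := by
    intro s hs
    have hs0 : 0 < s := hm.trans_le hs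
    rw [norm_mul, norm_neg, Real.norm_of_nonneg (by linarith),
      Real.norm_of_nonneg (by positivity)]
    gcongr ?_ * ?_
    exact Real.rpow_le_rpow_of_nonpos hm hs (by linarith)
  have hlip : ∀ s ∈ Set.Ici m, ∀ t ∈ Set.Ici m,
      ‖h s - h t‖ ≤ (α + 2) * m ^ (-(α + 2) - 1) * ‖s - t‖ := fun s hs t ht =>
    (convex_Ici m).norm_image_sub_le_of_norm_hasDerivWithin_le hder hb ht hs
  have hK : ∀ z : E2, K α z = (-(α * Cconst α)) • (h ‖z‖ • perp z) := by
    intro z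
    rw [K, hh, smul_smul]
    simp only
    rw [Real.rpow_neg (norm_nonneg _), div_eq_mul_inv]
  refine ⟨|α * Cconst α| * (m ^ (-(α + 2)) + (α + 2) * m ^ (-(α + 2) - 1) * max R 0), ?_, ?_⟩
  · have : 0 ≤ max R 0 := le_max_right _ _
    positivity
  intro z w hz hw hwR
  rw [hK, hK, ← smul_sub, norm_smul, norm_neg, Real.norm_eq_abs, mul_assoc]
  gcongr
  have : h ‖z‖ • perp z - h ‖w‖ • perp w = h ‖z‖ • perp (z - w) + (h ‖z‖ - h ‖w‖) • perp w := by
    rw [perp_sub]; module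
  rw [this]
  refine (norm_add_le _ _).trans ?_
  rw [norm_smul, norm_smul, perp_norm, perp_norm, add_mul]
  refine add_le_add ?_ ?_
  · gcongr
    rw [Real.norm_of_nonneg (by simp only [hh]; positivity)]
    exact Real.rpow_le_rpow_of_nonpos hm hz (by linarith)
  · have h1 := hlip _ hz _ hw
    have h2 : ‖‖z‖ - ‖w‖‖ ≤ ‖z - w‖ := abs_norm_sub_norm_le z w
    have h3 : ‖w‖ ≤ max R 0 := hwR.trans (le_max_left _ _)
    calc _ ≤ ((α + 2) * m ^ (-(α + 2) - 1) * ‖z - w‖) * max R 0 := by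
          gcongr
          exact h1.trans (by gcongr)
      _ = _ := by ring

/-- product integrability -/
lemma prod_int (β : ℝ) (hβ0 : 0 < β) (hβ : β < 2) (F g : E2 → ℝ) (hF : Integrable F)
    (B : ℝ) (hB : ∀ x, |F x| ≤ B) (hg : Integrable g) :
    Integrable (fun p : E2 × E2 => F p.1 * g p.2 * ‖p.1 - p.2‖ ^ (-β)) (volume.prod volume) := by
  set k1 : E2 → ℝ := (Metric.ball (0:E2) 1).indicator (fun z : E2 => ‖z‖ ^ (-β)) with hk1
  have hk1i : Integrable k1 := by
    rw [hk1, integrable_indicator_iff Metric.isOpen_ball.measurableSet]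
    exact ((rpow_locInt β hβ).integrableOn_isCompact (isCompact_closedBall 0 1)).mono_set
      Metric.ball_subset_closedBall
  have h1 := (hg.norm.convolution_integrand (ContinuousLinearMap.mul ℝ ℝ) hk1i).const_mul B
  have h2 := (hF.norm.mul_prod hg.norm)
  refine (h1.add h2).mono' ?_ ?_
  · refine ((hF.aestronglyMeasurable.comp_fst).mul (hg.aestronglyMeasurable.comp_snd)).mul ?_
    exact (by fun_prop : Measurable (fun p : E2 × E2 => ‖p.1 - p.2‖ ^ (-β))).aestronglyMeasurable
  · refine Filter.Eventually.of_forall fun p => ?_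
    have hB0 : 0 ≤ B := (abs_nonneg _).trans (hB 0)
    simp only [Pi.add_apply, ContinuousLinearMap.mul_apply', norm_mul, Real.norm_eq_abs]
    rw [abs_of_nonneg (by positivity : 0 ≤ ‖p.1 - p.2‖ ^ (-β))]
    by_cases hp : p.1 - p.2 ∈ Metric.ball (0:E2) 1
    · rw [hk1, Set.indicator_of_mem hp]
      have : |F p.1| * |g p.2| * ‖p.1 - p.2‖ ^ (-β) ≤ B * |g p.2| * ‖p.1 - p.2‖ ^ (-β) := by
        gcongr; exact hB _
      have h3 : 0 ≤ |F p.1| * |g p.2| := by positivity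
      linarith [mul_assoc B (|g p.2|) (‖p.1 - p.2‖ ^ (-β))]
    · rw [hk1, Set.indicator_of_notMem hp]
      have hp' : 1 ≤ ‖p.1 - p.2‖ := by simpa using hp
      have : ‖p.1 - p.2‖ ^ (-β) ≤ 1 := Real.rpow_le_one_of_one_le_of_nonpos hp' (by linarith)
      simp only [mul_zero, zero_add]
      exact mul_le_of_le_one_right (by positivity) this

/-- `L^∞` bound on the Riesz-type potential -/
lemma riesz_bound (β : ℝ) (hβ0 : 0 < β) (hβ : β < 2) : ∃ I : ℝ, 0 ≤ I ∧ ∀ (g : E2 → ℝ)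
    (H R : ℝ), 0 < R → (∀ x, 0 ≤ g x) → (∀ x, g x ≤ H) → Integrable g → ∀ x : E2,
    ∫ y, g y * ‖x - y‖ ^ (-β) ≤ H * (R ^ (2 - β) * I) + R ^ (-β) * ∫ y, g y := by
  refine ⟨∫ z in Metric.ball (0:E2) 1, ‖z‖ ^ (-β), integral_nonneg fun _ => by positivity, ?_⟩
  intro g H R hR hg0 hgH hgi x
  set k1 : E2 → ℝ := (Metric.ball (0:E2) R).indicator (fun z : E2 => ‖z‖ ^ (-β)) with hk1
  have hk1i : Integrable k1 := by
    rw [hk1, integrable_indicator_iff Metric.isOpen_ball.measurableSet]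
    exact ((rpow_locInt β hβ).integrableOn_isCompact (isCompact_closedBall 0 R)).mono_set
      Metric.ball_subset_closedBall
  have hsc : ∫ z, k1 z = R ^ (2 - β) * ∫ z in Metric.ball (0:E2) 1, ‖z‖ ^ (-β) := by
    rw [hk1, integral_indicator Metric.isOpen_ball.measurableSet]
    have := Measure.setIntegral_comp_smul_of_pos (volume : Measure E2)
      (fun z : E2 => ‖z‖ ^ (-β)) (Metric.ball (0:E2) 1) hR
    rw [smul_unitBall_of_pos hR, finrank_E2] at this
    have h2 : ∀ z : E2, ‖R • z‖ ^ (-β) = R ^ (-β) * ‖z‖ ^ (-β) := fun z => by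
      rw [norm_smul, Real.norm_of_nonneg hR.le, Real.mul_rpow hR.le (norm_nonneg _)]
    simp only [h2, integral_const_mul, smul_eq_mul] at this
    have h3 : R ^ (2 - β) = R ^ 2 * R ^ (-β) := by
      rw [sub_eq_add_neg, Real.rpow_add hR, Real.rpow_two]
    rw [h3, mul_assoc, this]
    field_simp
  rw [← hsc, ← integral_sub_left_eq_self k1 volume x, ← integral_const_mul, ← integral_const_mul,
    ← integral_add ((hk1i.comp_sub_left x).const_mul H) (hgi.const_mul _)]
  refine integral_mono_of_nonneg (Filter.Eventually.of_forall fun y => ?_)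
    (((hk1i.comp_sub_left x).const_mul H).add (hgi.const_mul _))
    (Filter.Eventually.of_forall fun y => ?_)
  · have := hg0 y
    simp only [Pi.zero_apply]
    positivity
  · simp only
    have h0 := hg0 y
    by_cases hp : x - y ∈ Metric.ball (0:E2) R
    · rw [hk1, Set.indicator_of_mem hp]
      have : g y * ‖x - y‖ ^ (-β) ≤ H * ‖x - y‖ ^ (-β) := by gcongr; exact hgH y
      have : 0 ≤ R ^ (-β) * g y := by positivity
      linarith
    · rw [hk1, Set.indicator_of_notMem hp]
      have hp' : R ≤ ‖x - y‖ := by simpa using hp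
      have : ‖x - y‖ ^ (-β) ≤ R ^ (-β) := Real.rpow_le_rpow_of_nonpos hR hp' (by linarith)
      rw [mul_zero, zero_add, mul_comm]
      gcongr

lemma divfree_reg (s δ : ℝ) (hδ : 0 < δ) (g : E2 → ℝ) (hg : ContDiff ℝ 1 g)
    (hgc : HasCompactSupport g) :
    ∫ z : E2, (‖z‖ ^ 2 + δ) ^ s * fderiv ℝ g z (perp z) = 0 := by
  set e0 : E2 := EuclideanSpace.single 0 1 with he0
  set e1 : E2 := EuclideanSpace.single 1 1 with he1
  set h : E2 → ℝ := fun z => (‖z‖ ^ 2 + δ) ^ s with hh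
  set c : E2 → ℝ := fun z => s * (‖z‖ ^ 2 + δ) ^ (s - 1) * 2 with hc
  have hpos : ∀ z : E2, 0 < ‖z‖ ^ 2 + δ := fun z => by positivity
  have hcd : ∀ z, HasFDerivAt h (c z • innerSL ℝ z) z := by
    intro z
    have h1 : HasFDerivAt (fun z : E2 => ‖z‖ ^ 2 + δ) (2 • innerSL ℝ z) z :=
      (hasStrictFDerivAt_norm_sq z).hasFDerivAt.add_const δ
    have h2 := h1.rpow_const (p := s) (Or.inl (hpos z).ne')
    have e : c z • innerSL ℝ z = (s * (‖z‖ ^ 2 + δ) ^ (s - 1)) • (2 • innerSL ℝ z) := by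
      rw [← Nat.cast_smul_eq_nsmul ℝ, smul_smul]; simp [hc]
    rw [e]
    exact h2
  have hcont : Continuous h := continuous_iff_continuousAt.2 fun z => (hcd z).continuousAt
  have hccont : Continuous c := by
    simp only [hc]
    have : Continuous fun z : E2 => (‖z‖ ^ 2 + δ) ^ (s - 1) :=
      Continuous.rpow_const (by fun_prop) fun z => Or.inl (hpos z).ne'
    fun_prop
  have hp : ∀ (i : Fin 2) (z : E2), HasFDerivAt (fun z : E2 => h z * z i)
      (h z • (EuclideanSpace.proj i : E2 →L[ℝ] ℝ) + z i • (c z • innerSL ℝ z)) z := by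
    intro i z
    exact (hcd z).mul (EuclideanSpace.proj i : E2 →L[ℝ] ℝ).hasFDerivAt
  have hfd : ∀ i, Differentiable ℝ (fun z : E2 => h z * z i) := fun i z => (hp i z).differentiableAt
  have hgf : Continuous (fderiv ℝ g) := hg.continuous_fderiv (by norm_num)
  have hgs : ∀ v, HasCompactSupport (fun z => fderiv ℝ g z v) := fun v => hgc.fderiv_apply ℝ v
  have ibp : ∀ (i : Fin 2) (v : E2), ∫ z, (h z * z i) * fderiv ℝ g z v
      = - ∫ z, (h z * v i + z i * (c z * ⟪z, v⟫)) * g z := by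
    intro i v
    have e : ∀ z, fderiv ℝ (fun z : E2 => h z * z i) z v = h z * v i + z i * (c z * ⟪z, v⟫) := by
      intro z; rw [(hp i z).fderiv]; simp
    rw [integral_mul_fderiv_eq_neg_fderiv_mul_of_integrable]
    · simp only [e]
    · simp only [e]
      refine Continuous.integrable_of_hasCompactSupport ?_ hgc.mul_left
      have := hg.continuous
      fun_prop
    · refine Continuous.integrable_of_hasCompactSupport ?_ (hgs v).mul_left
      fun_prop
    · refine Continuous.integrable_of_hasCompactSupport ?_ hgc.mul_left
      have := hg.continuous
      fun_prop
    · exact fun x _ => hfd i x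
    · exact fun x _ => hg.differentiable (by norm_num) x
  have hperp : ∀ z : E2, perp z = (-(z 1)) • e0 + (z 0) • e1 := by
    intro z; ext i; fin_cases i <;> simp [perp, he0, he1]
  have : ∀ z : E2, (‖z‖ ^ 2 + δ) ^ s * fderiv ℝ g z (perp z)
      = (h z * z 0) * fderiv ℝ g z e1 - (h z * z 1) * fderiv ℝ g z e0 := by
    intro z
    rw [hperp z, map_add, map_smul, map_smul]
    simp only [hh, smul_eq_mul]; ring
  simp only [this]
  rw [integral_sub, ibp, ibp]
  · have : ∀ z : E2, (h z * e1 0 + z 0 * (c z * ⟪z, e1⟫)) * g z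
      = (h z * e0 1 + z 1 * (c z * ⟪z, e0⟫)) * g z := by
      intro z
      simp [he0, he1, EuclideanSpace.inner_single_right]; left; ring
    simp only [this]; ring
  · refine Continuous.integrable_of_hasCompactSupport ?_ (hgs e1).mul_left
    fun_prop
  · refine Continuous.integrable_of_hasCompactSupport ?_ (hgs e0).mul_left
    fun_prop

lemma divfree (α : ℝ) (hα : 0 < α) (hα1 : α < 1) (g : E2 → ℝ) (hg : ContDiff ℝ 1 g)
    (hgc : HasCompactSupport g) : ∫ z : E2, fderiv ℝ g z (K α z) = 0 := by
  have hgf : Continuous (fderiv ℝ g) := hg.continuous_fderiv (by norm_num)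
  have hlim : Filter.Tendsto (fun n : ℕ => ∫ z : E2, (-(α * Cconst α)) *
      ((‖z‖ ^ 2 + 1 / ((n : ℝ) + 1)) ^ (-((α + 2) / 2)) * fderiv ℝ g z (perp z))) Filter.atTop
      (nhds (∫ z : E2, fderiv ℝ g z (K α z))) := by
    have hli := (rpow_locInt (1 + α) (by linarith))
    have hb : Integrable (fun z : E2 => ‖fderiv ℝ g z‖ • ‖z‖ ^ (-(1 + α))) :=
      hli.integrable_smul_left_of_hasCompactSupport hgf.norm (hgc.fderiv ℝ).norm
    refine tendsto_integral_of_dominated_convergence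
      (fun z => |α * Cconst α| * (‖fderiv ℝ g z‖ • ‖z‖ ^ (-(1 + α)))) ?_ (hb.const_mul _) ?_ ?_
    · intro n
      refine Continuous.aestronglyMeasurable ?_
      have : Continuous fun z : E2 => (‖z‖ ^ 2 + 1 / ((n : ℝ) + 1)) ^ (-((α + 2) / 2)) :=
        Continuous.rpow_const (by fun_prop) fun z => Or.inl (by positivity)
      have := perp_cont
      fun_prop
    · intro n
      have hne : ∀ᵐ z : E2, z ≠ 0 := by simp [ae_iff]
      filter_upwards [hne] with z hz
      have hz' : 0 < ‖z‖ := norm_pos_iff.2 hz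
      rw [norm_mul, norm_neg, Real.norm_eq_abs]
      gcongr
      rw [norm_mul, Real.norm_of_nonneg (by positivity), smul_eq_mul]
      have h1 : (‖z‖ ^ 2 + 1 / ((n : ℝ) + 1)) ^ (-((α + 2) / 2)) ≤ (‖z‖ ^ 2) ^ (-((α + 2) / 2)) := by
        apply Real.rpow_le_rpow_of_nonpos (by positivity) _ (by linarith)
        have : 0 ≤ 1 / ((n : ℝ) + 1) := by positivity
        linarith
      have h2 : (‖z‖ ^ 2) ^ (-((α + 2) / 2)) = ‖z‖ ^ (-(α + 2)) := by
        rw [← Real.rpow_natCast_mul hz'.le]; congr 1; push_cast; ring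
      have h3 : ‖z‖ ^ (-(1 + α)) = ‖z‖ ^ (-(α + 2)) * ‖z‖ := by
        rw [show -(1 + α) = -(α + 2) + 1 by ring, Real.rpow_add hz', Real.rpow_one]
      have h4 : ‖fderiv ℝ g z (perp z)‖ ≤ ‖fderiv ℝ g z‖ * ‖z‖ := by
        have := (fderiv ℝ g z).le_opNorm (perp z)
        rwa [perp_norm] at this
      rw [h3]
      calc _ ≤ ‖z‖ ^ (-(α + 2)) * (‖fderiv ℝ g z‖ * ‖z‖) := by
            rw [h2] at h1
            gcongr
        _ = _ := by ring
    · have hne : ∀ᵐ z : E2, z ≠ 0 := by simp [ae_iff]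
      filter_upwards [hne] with z hz
      have hz' : 0 < ‖z‖ := norm_pos_iff.2 hz
      have : fderiv ℝ g z (K α z) = (-(α * Cconst α)) *
          ((‖z‖ ^ 2 + 0) ^ (-((α + 2) / 2)) * fderiv ℝ g z (perp z)) := by
        rw [K, map_smul, smul_eq_mul, add_zero, ← Real.rpow_natCast_mul hz'.le, div_eq_mul_inv,
          ← Real.rpow_neg hz'.le]
        have : (((2:ℕ):ℝ) * -((α + 2) / 2)) = -(α + 2) := by push_cast; ring
        rw [this]; ring
      rw [this]
      refine Filter.Tendsto.const_mul _ (Filter.Tendsto.mul_const _ ?_)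
      refine Filter.Tendsto.rpow_const ?_ (Or.inl (by positivity))
      exact tendsto_const_nhds.add tendsto_one_div_add_atTop_nhds_zero_nat
  have hz : ∀ n : ℕ, ∫ z : E2, (-(α * Cconst α)) *
      ((‖z‖ ^ 2 + 1 / ((n : ℝ) + 1)) ^ (-((α + 2) / 2)) * fderiv ℝ g z (perp z)) = 0 := by
    intro n
    rw [integral_const_mul, divfree_reg _ _ (by positivity) g hg hgc, mul_zero]
  simp only [hz] at hlim
  exact (tendsto_nhds_unique hlim tendsto_const_nhds)

lemma divfree_shift (α : ℝ) (hα : 0 < α) (hα1 : α < 1) (g : E2 → ℝ) (hg : ContDiff ℝ 1 g)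
    (hgc : HasCompactSupport g) (y : E2) : ∫ x : E2, fderiv ℝ g x (K α (x - y)) = 0 := by
  rw [← integral_add_right_eq_self _ y]
  have h1 := divfree α hα hα1 (fun z => g (z + y)) (hg.comp (by fun_prop))
    (hgc.comp_homeomorph (Homeomorph.addRight y))
  rw [← h1]
  refine integral_congr_ae (Filter.Eventually.of_forall fun z => ?_)
  simp only [add_sub_cancel_right]
  rw [fderiv_comp_add_right]

/-- velocity -/
def vel (α : ℝ) (ϑ : E2 → ℝ) (p : E2) : E2 := ∫ y : E2, ϑ y • K α (p - y)

lemma vel_int (α : ℝ) (hα1 : α < 1) (ϑ : E2 → ℝ) (hc : Continuous ϑ)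
    (hs : HasCompactSupport ϑ) (p : E2) : Integrable (fun y : E2 => ϑ y • K α (p - y)) := by
  have h1 : Integrable (fun z : E2 => ϑ (p - z) • K α z) :=
    (K_locInt α hα1).integrable_smul_left_of_hasCompactSupport (by fun_prop)
      (hs.comp_homeomorph (Homeomorph.subLeft p))
  have := h1.comp_sub_left p
  simpa using this

/-- integrability of the kernel against a covector field -/
lemma prod_int_K (α : ℝ) (hα : 0 < α) (hα1 : α < 1) (ϑ : E2 → ℝ) (hc : Continuous ϑ)
    (hs : HasCompactSupport ϑ) (F : E2 → (E2 →L[ℝ] ℝ)) (hF : Continuous F)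
    (hFs : HasCompactSupport F) :
    Integrable (fun p : E2 × E2 => ϑ p.2 * F p.1 (K α (p.1 - p.2))) (volume.prod volume) := by
  obtain ⟨B, hB⟩ := hF.bounded_above_of_compact_support hFs
  have h1 := prod_int (1 + α) (by linarith) (by linarith) (fun x => ‖F x‖) (fun y => ‖ϑ y‖)
    (hF.norm.integrable_of_hasCompactSupport hFs.norm) B (fun x => by simpa using hB x)
    (hc.norm.integrable_of_hasCompactSupport hs.norm)
  refine (h1.const_mul |α * Cconst α|).mono' ?_ (Filter.Eventually.of_forall fun p => ?_)
  · refine Measurable.aestronglyMeasurable ?_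
    have hK := K_meas α
    have : Measurable fun p : E2 × E2 => F p.1 (K α (p.1 - p.2)) := by
      have h := (isBoundedBilinearMap_apply (𝕜 := ℝ) (E := E2) (F := ℝ)).continuous.measurable
      have h2 : Measurable fun p : E2 × E2 => (F p.1, K α (p.1 - p.2)) :=
        (hF.measurable.comp measurable_fst).prodMk (hK.comp (by fun_prop))
      exact h.comp h2
    have := hc.measurable
    fun_prop
  · rw [norm_mul]
    have h2 := (F p.1).le_opNorm (K α (p.1 - p.2))
    have h3 := K_norm α (p.1 - p.2)
    calc _ ≤ ‖ϑ p.2‖ * (‖F p.1‖ * (|α * Cconst α| * ‖p.1 - p.2‖ ^ (-(1 + α)))) := by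
          gcongr
          exact h2.trans (by gcongr)
      _ = _ := by ring

lemma vel_apply (α : ℝ) (hα1 : α < 1) (ϑ : E2 → ℝ) (hc : Continuous ϑ)
    (hs : HasCompactSupport ϑ) (p : E2) (Lm : E2 →L[ℝ] ℝ) :
    Lm (vel α ϑ p) = ∫ y, ϑ y * Lm (K α (p - y)) := by
  rw [vel, ← Lm.integral_comp_comm (vel_int α hα1 ϑ hc hs p)]
  simp

/-- integration by parts for the transport term -/
lemma transport_ibp (α : ℝ) (hα : 0 < α) (hα1 : α < 1) (ϑ : E2 → ℝ) (hc : ContDiff ℝ 1 ϑ)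
    (hs : HasCompactSupport ϑ) (w : E2 → ℝ) (hw : ContDiff ℝ 1 w) (hws : HasCompactSupport w)
    (b : E2) :
    ∫ x, w x * fderiv ℝ ϑ x (vel α ϑ x - b) = - ∫ x, ϑ x * fderiv ℝ w x (vel α ϑ x - b) := by
  have hϑf : Continuous (fderiv ℝ ϑ) := hc.continuous_fderiv (by norm_num)
  have hwf : Continuous (fderiv ℝ w) := hw.continuous_fderiv (by norm_num)
  have hcc := hc.continuous
  have hwc := hw.continuous
  have I1 := prod_int_K α hα hα1 ϑ hcc hs (fun x => w x • fderiv ℝ ϑ x) (by fun_prop)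
    (hws.smul_right)
  have I2 := prod_int_K α hα hα1 ϑ hcc hs (fun x => ϑ x • fderiv ℝ w x) (by fun_prop)
    (hs.smul_right)
  have key : ∀ y, ∫ x, ϑ y * (w x • fderiv ℝ ϑ x) (K α (x - y))
      + ϑ y * (ϑ x • fderiv ℝ w x) (K α (x - y)) = 0 := by
    intro y
    have h := divfree_shift α hα hα1 (fun x => w x * ϑ x) (hw.mul hc) hws.mul_right y
    have h2 : ∀ x, ϑ y * (w x • fderiv ℝ ϑ x) (K α (x - y))
      + ϑ y * (ϑ x • fderiv ℝ w x) (K α (x - y))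
       = ϑ y * fderiv ℝ (fun x => w x * ϑ x) x (K α (x - y)) := by
      intro x
      rw [fderiv_fun_mul (hw.differentiable (by norm_num) x) (hc.differentiable (by norm_num) x)]
      simp; ring
    simp only [h2]
    rw [integral_const_mul, h, mul_zero]
  have kk : ∫ x, ∫ y, (ϑ y * (w x • fderiv ℝ ϑ x) (K α (x - y))
      + ϑ y * (ϑ x • fderiv ℝ w x) (K α (x - y))) = 0 := by
    rw [integral_integral_swap]
    · simp only [key, integral_zero]
    · exact I1.add I2
  have kk2 : ∫ x, ∫ y, (ϑ y * (w x • fderiv ℝ ϑ x) (K α (x - y))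
      + ϑ y * (ϑ x • fderiv ℝ w x) (K α (x - y))) =
      (∫ x, ∫ y, ϑ y * (w x • fderiv ℝ ϑ x) (K α (x - y))) +
      ∫ x, ∫ y, ϑ y * (ϑ x • fderiv ℝ w x) (K α (x - y)) :=
    integral_integral_add I1 I2
  have J1 : Integrable fun x => ∫ y, ϑ y * (w x • fderiv ℝ ϑ x) (K α (x - y)) := I1.integral_prod_left
  have J2 : Integrable fun x => ∫ y, ϑ y * (ϑ x • fderiv ℝ w x) (K α (x - y)) := I2.integral_prod_left
  have e1 : ∀ x, w x * fderiv ℝ ϑ x (vel α ϑ x - b) =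
      (∫ y, ϑ y * (w x • fderiv ℝ ϑ x) (K α (x - y))) - w x * fderiv ℝ ϑ x b := by
    intro x
    rw [← vel_apply α hα1 ϑ hcc hs x]
    simp; ring
  have e2 : ∀ x, ϑ x * fderiv ℝ w x (vel α ϑ x - b) =
      (∫ y, ϑ y * (ϑ x • fderiv ℝ w x) (K α (x - y))) - fderiv ℝ w x b * ϑ x := by
    intro x
    rw [← vel_apply α hα1 ϑ hcc hs x]
    simp; ring
  have i1 : Integrable fun x => w x * fderiv ℝ ϑ x b :=
    Continuous.integrable_of_hasCompactSupport (by fun_prop) hws.mul_right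
  have i2 : Integrable fun x => fderiv ℝ w x b * ϑ x :=
    Continuous.integrable_of_hasCompactSupport (by fun_prop) hs.mul_left
  have i3 : Integrable fun x => w x * ϑ x :=
    Continuous.integrable_of_hasCompactSupport (by fun_prop) hs.mul_left
  have hb := integral_mul_fderiv_eq_neg_fderiv_mul_of_integrable i2 i1 i3
    (fun x _ => hw.differentiable (by norm_num) x) (fun x _ => hc.differentiable (by norm_num) x)
  simp only [e1, e2]
  rw [integral_sub J1 i1, integral_sub J2 i2, hb]
  linarith [kk.symm.trans kk2]

structure Cut (r : ℝ) (χ : E2 → ℝ) : Prop where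
  smooth : ContDiff ℝ 2 χ
  one : ∀ z, ‖z‖ ≤ r → χ z = 1
  zero : ∀ z, 2 * r ≤ ‖z‖ → χ z = 0
  nonneg : ∀ z, 0 ≤ χ z
  le_one : ∀ z, χ z ≤ 1

structure Adm (r : ℝ) (w : E2 → ℝ) (lam : ℝ) : Prop where
  smooth : ContDiff ℝ 2 w
  zero : ∀ z, 2 * r ≤ ‖z‖ → w z = 0
  quad : ∀ z, ‖z‖ ≤ r → w z = w 0 - lam * ‖z‖ ^ 2

lemma exists_cut (r : ℝ) (hr : 0 < r) : ∃ χ, Cut r χ := by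
  let b : ContDiffBump (0:E2) := ⟨r, 2 * r, hr, by linarith⟩
  refine ⟨b, b.contDiff, fun z hz => b.one_of_mem_closedBall (by simpa using hz),
    fun z hz => b.zero_of_le_dist (by simpa using hz), fun z => b.nonneg, fun z => b.le_one⟩

lemma Cut.adm {r : ℝ} (hr : 0 < r) {χ : E2 → ℝ} (h : Cut r χ) : Adm r χ 0 :=
  ⟨h.smooth, h.zero, fun z hz => by rw [h.one z hz, h.one 0 (by simpa using hr.le)]; simp⟩

lemma Cut.adm2 {r : ℝ} (hr : 0 < r) {χ : E2 → ℝ} (h : Cut r χ) :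
    Adm r (fun z => χ z * (4 * r ^ 2 - ‖z‖ ^ 2)) 1 := by
  refine ⟨h.smooth.mul (contDiff_const.sub (contDiff_norm_sq ℝ)), fun z hz => by simp [h.zero z hz],
    fun z hz => ?_⟩
  rw [h.one z hz, h.one 0 (by simpa using hr.le)]; simp

lemma hcs_of_zero {r : ℝ} {w : E2 → ℝ} (h : ∀ z, 2 * r ≤ ‖z‖ → w z = 0) :
    HasCompactSupport w := by
  refine HasCompactSupport.intro (isCompact_closedBall (0:E2) (2 * r)) fun z hz => h z ?_
  have : 2 * r < ‖z‖ := by simpa using hz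
  exact this.le

lemma Adm.hcs {r : ℝ} {w : E2 → ℝ} {lam : ℝ} (h : Adm r w lam) : HasCompactSupport w :=
  hcs_of_zero h.zero

lemma Adm.fzero {r : ℝ} {w : E2 → ℝ} {lam : ℝ} (h : Adm r w lam) (z : E2) (hz : 2 * r < ‖z‖) :
    fderiv ℝ w z = 0 := by
  have : w =ᶠ[nhds z] fun _ => (0:ℝ) := by
    have : ∀ᶠ y in nhds z, 2 * r < ‖y‖ := continuous_norm.continuousAt.eventually_const_lt hz
    filter_upwards [this] with y hy using h.zero y hy.le
  rw [this.fderiv_eq]; simp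

lemma Adm.fquad {r : ℝ} {w : E2 → ℝ} {lam : ℝ} (h : Adm r w lam) (z : E2) (hz : ‖z‖ < r) (v : E2) :
    fderiv ℝ w z v = -(2 * lam) * ⟪z, v⟫ := by
  have : w =ᶠ[nhds z] fun y => w 0 - lam * ‖y‖ ^ 2 := by
    have : ∀ᶠ y in nhds z, ‖y‖ < r := continuous_norm.continuousAt.eventually_lt_const hz
    filter_upwards [this] with y hy using h.quad y hy.le
  rw [this.fderiv_eq]
  have h1 := ((hasStrictFDerivAt_norm_sq z).hasFDerivAt.const_mul lam).const_sub (w 0)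
  rw [h1.fderiv]
  simp; ring

lemma Adm.lip {r : ℝ} (hr : 0 < r) {w : E2 → ℝ} {lam : ℝ} (h : Adm r w lam) : ∃ L : ℝ, 0 ≤ L ∧
    (∀ z z', ‖fderiv ℝ w z - fderiv ℝ w z'‖ ≤ L * ‖z - z'‖) ∧ (∀ z, ‖fderiv ℝ w z‖ ≤ L * ‖z‖) ∧
    (∀ z, ‖fderiv ℝ w z‖ ≤ 2 * r * L) := by
  have hc : ContDiff ℝ 1 (fderiv ℝ w) := h.smooth.fderiv_right (by norm_num)
  obtain ⟨L, hL⟩ := hc.lipschitzWith_of_hasCompactSupport (h.hcs.fderiv ℝ) (by norm_num)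
  have h1 : ∀ z z', ‖fderiv ℝ w z - fderiv ℝ w z'‖ ≤ L * ‖z - z'‖ := fun z z' => hL.norm_sub_le z z'
  have h2 : ∀ z, ‖fderiv ℝ w z‖ ≤ L * ‖z‖ := by
    intro z
    have := h1 z 0
    have h0 : fderiv ℝ w 0 = 0 := by
      ext v; rw [h.fquad 0 (by simpa using hr)]; simp
    simpa [h0] using this
  refine ⟨L, L.2, h1, h2, fun z => ?_⟩
  rcases le_or_gt ‖z‖ (2 * r) with hz | hz
  · refine (h2 z).trans ?_
    rw [mul_comm]
    gcongr
  · rw [h.fzero z hz, norm_zero]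
    have := L.2
    positivity

/-- the weight -/
def rho (r : ℝ) (χ : E2 → ℝ) {N : ℕ} (p : Fin N → E2) (x : E2) : ℝ :=
  4 * r ^ 2 - ∑ i, χ (x - p i) * (4 * r ^ 2 - ‖x - p i‖ ^ 2)

def SepPts (r : ℝ) {N : ℕ} (p : Fin N → E2) : Prop := ∀ i j, i ≠ j → 8 * r ≤ ‖p i - p j‖

lemma SepPts.far {r : ℝ} {N : ℕ} {p : Fin N → E2} (h : SepPts r p) {i j : Fin N}
    (hij : i ≠ j) {x : E2} (hx : ‖x - p i‖ ≤ 2 * r) : 6 * r ≤ ‖x - p j‖ := by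
  have h1 := h i j hij
  have h2 : ‖p i - p j‖ ≤ ‖x - p j‖ + ‖x - p i‖ := by
    have := norm_sub_le (x - p j) (x - p i)
    rwa [show x - p j - (x - p i) = p i - p j by abel] at this
  linarith

lemma rho_near {r : ℝ} (hr : 0 < r) {χ : E2 → ℝ} (h : Cut r χ) {N : ℕ} {p : Fin N → E2}
    (hp : SepPts r p) {i : Fin N} {x : E2} (hx : ‖x - p i‖ ≤ 2 * r) :
    rho r χ p x = 4 * r ^ 2 - χ (x - p i) * (4 * r ^ 2 - ‖x - p i‖ ^ 2) := by
  unfold rho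
  rw [Finset.sum_eq_single i]
  · intro j _ hj
    rw [h.zero _ (by linarith [hp.far hj.symm hx]), zero_mul]
  · simp

lemma rho_near_ge {r : ℝ} (hr : 0 < r) {χ : E2 → ℝ} (h : Cut r χ) {N : ℕ} {p : Fin N → E2}
    (hp : SepPts r p) {i : Fin N} {x : E2} (hx : ‖x - p i‖ ≤ 2 * r) :
    ‖x - p i‖ ^ 2 ≤ rho r χ p x ∧ rho r χ p x ≤ 4 * r ^ 2 := by
  rw [rho_near hr h hp hx]
  have h1 : ‖x - p i‖ ^ 2 ≤ (2 * r) ^ 2 := by gcongr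
  have h0 := h.nonneg (x - p i)
  have h2 := h.le_one (x - p i)
  constructor
  · nlinarith
  · nlinarith

lemma rho_far {r : ℝ} {χ : E2 → ℝ} (h : Cut r χ) {N : ℕ} {p : Fin N → E2}
    {x : E2} (hx : ∀ i, 2 * r ≤ ‖x - p i‖) : rho r χ p x = 4 * r ^ 2 := by
  unfold rho
  rw [Finset.sum_eq_zero, sub_zero]
  intro i _
  rw [h.zero _ (hx i), zero_mul]

lemma rho_bd {r : ℝ} (hr : 0 < r) {χ : E2 → ℝ} (h : Cut r χ) {N : ℕ} {p : Fin N → E2}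
    (hp : SepPts r p) (x : E2) : 0 ≤ rho r χ p x ∧ rho r χ p x ≤ 4 * r ^ 2 := by
  by_cases hx : ∀ i, 2 * r ≤ ‖x - p i‖
  · rw [rho_far h hx]; exact ⟨by positivity, le_rfl⟩
  · push Not at hx
    obtain ⟨i, hi⟩ := hx
    have := rho_near_ge hr h hp hi.le
    exact ⟨(by positivity : 0 ≤ ‖x - p i‖ ^ 2).trans this.1, this.2⟩

lemma rho_out {r : ℝ} (hr : 0 < r) {χ : E2 → ℝ} (h : Cut r χ) {N : ℕ} {p : Fin N → E2}
    (hp : SepPts r p) (x : E2) {η : ℝ} (hη : 0 ≤ η) (hηr : η ≤ 2 * r) (hx : ∀ i, η ≤ ‖x - p i‖) :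
    η ^ 2 ≤ rho r χ p x := by
  by_cases hx' : ∀ i, 2 * r ≤ ‖x - p i‖
  · rw [rho_far h hx']; nlinarith
  · push Not at hx'
    obtain ⟨i, hi⟩ := hx'
    have := (rho_near_ge hr h hp hi.le).1
    have := hx i
    nlinarith

lemma rho_cont {r : ℝ} {χ : E2 → ℝ} (h : Cut r χ) {N : ℕ} (p : Fin N → E2) :
    Continuous (rho r χ p) := by
  unfold rho
  have := h.smooth.continuous
  fun_prop

lemma chi_other {r : ℝ} (hr : 0 < r) {χ : E2 → ℝ} (h : Cut r χ) {N : ℕ} {p : Fin N → E2}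
    (hp : SepPts r p) {i j : Fin N} (hij : i ≠ j) {x : E2} (hx : ‖x - p i‖ ≤ 2 * r) :
    χ (x - p j) = 0 := h.zero _ (by linarith [hp.far hij hx])

/-- the integrand -/
def Aint (α : ℝ) (w χ : E2 → ℝ) {N : ℕ} (p : Fin N → E2) (i : Fin N) (x y : E2) : ℝ :=
  fderiv ℝ w (x - p i) (K α (x - y)) -
    ∑ j ∈ Finset.univ.erase i, χ (y - p j) * fderiv ℝ w (x - p i) (K α (p i - p j))

lemma pointwise_core (α : ℝ) (hα : 0 < α) {r R lam : ℝ} (hr : 0 < r) {χ w : E2 → ℝ}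
    (h : Cut r χ) (hw : Adm r w lam) :
    ∃ C : ℝ, 0 ≤ C ∧ ∀ (N : ℕ) (p : Fin N → E2), SepPts r p → (∀ i j, ‖p i - p j‖ ≤ R) →
      ∀ i l : Fin N, l ≠ i → ∀ x y : E2, ‖x - p i‖ < r / 2 → ‖y - p l‖ < r / 2 → 
      |Aint α w χ p i x y + Aint α w χ p i y x| ≤ C * (rho r χ p x + rho r χ p y) := by
  obtain ⟨L, hL0, hL1, hL2, hL3⟩ := hw.lip hr
  obtain ⟨Lk, hLk0, hLk⟩ := K_lip α hα (m := r) (R := R) hr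
  refine ⟨2 * L * Lk, by positivity, ?_⟩
  intro N p hp hpR i l hl x y hx hy
  have hyi : 6 * r ≤ ‖y - p i‖ := hp.far hl (by linarith)
  have hDy : fderiv ℝ w (y - p i) = 0 := hw.fzero _ (by linarith)
  have hsum : ∑ j ∈ Finset.univ.erase i, χ (y - p j) * fderiv ℝ w (x - p i) (K α (p i - p j))
      = fderiv ℝ w (x - p i) (K α (p i - p l)) := by
    rw [Finset.sum_eq_single l]
    · rw [h.one _ (by linarith), one_mul]
    · intro j _ hj
      rw [chi_other hr h hp (Ne.symm hj) (x := y) (by linarith), zero_mul]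
    · intro hh; simp [hl] at hh
  have e : Aint α w χ p i x y + Aint α w χ p i y x
      = fderiv ℝ w (x - p i) (K α (x - y) - K α (p i - p l)) := by
    simp only [Aint, hsum, hDy, map_sub]; simp
  rw [e]
  have hd : ‖(x - y) - (p i - p l)‖ ≤ ‖x - p i‖ + ‖y - p l‖ := by
    have := norm_sub_le (x - p i) (y - p l)
    rwa [show x - p i - (y - p l) = (x - y) - (p i - p l) by abel] at this
  have h8 := hp i l hl.symm
  have hxy : r ≤ ‖x - y‖ := by
    have : ‖p i - p l‖ ≤ ‖x - y‖ + ‖(x - y) - (p i - p l)‖ := by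
      have := norm_sub_le (x - y) ((x - y) - (p i - p l))
      rwa [show x - y - ((x - y) - (p i - p l)) = p i - p l by abel] at this
    linarith
  have h1 := hLk (x - y) (p i - p l) hxy (by linarith) (hpR i l)
  have h2 := (fderiv ℝ w (x - p i)).le_opNorm (K α (x - y) - K α (p i - p l))
  have h3 := hL2 (x - p i)
  have ra := (rho_near_ge hr h hp (x := x) (i := i) (by linarith)).1
  have rb := (rho_near_ge hr h hp (x := y) (i := l) (by linarith)).1
  set A := ‖x - p i‖
  set B := ‖y - p l‖
  have hA : 0 ≤ A := norm_nonneg _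
  have hB : 0 ≤ B := norm_nonneg _
  calc _ ≤ (L * A) * (Lk * (A + B)) := by
        refine h2.trans ?_
        gcongr
        exact h1.trans (by gcongr)
    _ = (L * Lk) * (A * (A + B)) := by ring
    _ ≤ (L * Lk) * (2 * (A ^ 2 + B ^ 2)) := by
        refine mul_le_mul_of_nonneg_left ?_ (by positivity)
        nlinarith [sq_nonneg (A - B)]
    _ ≤ (L * Lk) * (2 * (rho r χ p x + rho r χ p y)) := by gcongr
    _ = _ := by ring

set_option maxHeartbeats 1000000 in
lemma pointwise (α : ℝ) (hα : 0 < α) {r lam : ℝ} (R : ℝ) (hr : 0 < r) {χ w : E2 → ℝ}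
    (h : Cut r χ) (hw : Adm r w lam) (N : ℕ) :
    ∃ C : ℝ, 0 ≤ C ∧ ∀ (p : Fin N → E2), SepPts r p → (∀ i j, ‖p i - p j‖ ≤ R) →
      ∀ i : Fin N, ∀ x y : E2,
      |Aint α w χ p i x y + Aint α w χ p i y x| ≤ C * (rho r χ p x + rho r χ p y)
        + C * (rho r χ p x * rho r χ p y * ‖x - y‖ ^ (-α)) := by
  obtain ⟨C0, hC00, hC0⟩ := pointwise_core α hα (R := R) hr h hw
  obtain ⟨L, hL0, hL1, hL2, hL3⟩ := hw.lip hr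
  set κ := |α * Cconst α| with hκ
  have hκ0 : 0 ≤ κ := abs_nonneg _
  set k0 := κ * (r / 4) ^ (-(1 + α)) with hk0
  have hk00 : 0 ≤ k0 := by positivity
  set q := (N : ℝ) * (2 * r * L * k0) with hq
  have hq0 : 0 ≤ q := by positivity
  set C1 := (4 * r * L * k0 + 2 * q) * (4 / r ^ 2) with hC1
  have hC10 : 0 ≤ C1 := by positivity
  set C2 := κ * L * (16 / r ^ 4) with hC2
  have hC20 : 0 ≤ C2 := by positivity
  refine ⟨C0 + C1 + C2, by positivity, ?_⟩
  intro p hp hpR i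
  have hQ : ∀ x y, |∑ j ∈ Finset.univ.erase i,
      χ (y - p j) * fderiv ℝ w (x - p i) (K α (p i - p j))| ≤ q := by
    intro x y
    refine (Finset.abs_sum_le_sum_abs _ _).trans ?_
    have : ∀ j ∈ Finset.univ.erase i, |χ (y - p j) * fderiv ℝ w (x - p i) (K α (p i - p j))|
        ≤ 2 * r * L * k0 := by
      intro j hj
      have hij : i ≠ j := by simpa [eq_comm] using hj
      rw [abs_mul, abs_of_nonneg (h.nonneg _)]
      have h1 := (fderiv ℝ w (x - p i)).le_opNorm (K α (p i - p j))
      have h2 := K_norm_le α hα (m := r / 4) (by positivity) (p i - p j)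
        (by linarith [hp i j hij])
      have h3 := hL3 (x - p i)
      have h4 : ‖fderiv ℝ w (x - p i)‖ * ‖K α (p i - p j)‖ ≤ 2 * r * L * k0 := by gcongr
      have h5 := h.le_one (y - p j)
      have h6 := h.nonneg (y - p j)
      rw [Real.norm_eq_abs] at h1
      have h7 := abs_nonneg (fderiv ℝ w (x - p i) (K α (p i - p j)))
      nlinarith
    refine (Finset.sum_le_sum this).trans ?_
    rw [Finset.sum_const, nsmul_eq_mul, hq]
    gcongr
    exact (Finset.card_le_univ _).trans (by simp)
  have hsplit : ∀ x y, Aint α w χ p i x y + Aint α w χ p i y x =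
      (fderiv ℝ w (x - p i) - fderiv ℝ w (y - p i)) (K α (x - y))
      - (∑ j ∈ Finset.univ.erase i, χ (y - p j) * fderiv ℝ w (x - p i) (K α (p i - p j)))
      - (∑ j ∈ Finset.univ.erase i, χ (x - p j) * fderiv ℝ w (y - p i) (K α (p i - p j))) := by
    intro x y
    simp only [Aint]
    rw [← neg_sub x y, K_neg]
    simp; ring
  have hρ := rho_bd hr h hp
  have hpos : ∀ x y, 0 ≤ rho r χ p x * rho r χ p y * ‖x - y‖ ^ (-α) := fun x y => by
    have := (hρ x).1
    have := (hρ y).1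
    positivity
  -- mixed case
  have hmix : ∀ x y : E2, ∀ k, ‖x - p k‖ < r / 2 → (∀ l, r / 2 ≤ ‖y - p l‖) →
      |Aint α w χ p i x y + Aint α w χ p i y x| ≤ C1 * rho r χ p y := by
    intro x y k hk hy
    have hP : |(fderiv ℝ w (x - p i) - fderiv ℝ w (y - p i)) (K α (x - y))| ≤ 4 * r * L * k0 := by
      rcases le_or_gt (r / 4) ‖x - y‖ with hxy | hxy
      · have h1 := (fderiv ℝ w (x - p i) - fderiv ℝ w (y - p i)).le_opNorm (K α (x - y))
        have h2 := K_norm_le α hα (m := r / 4) (by positivity) (x - y) hxy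
        have h3 := norm_sub_le (fderiv ℝ w (x - p i)) (fderiv ℝ w (y - p i))
        have h4 := hL3 (x - p i)
        have h5 := hL3 (y - p i)
        have h6 : ‖fderiv ℝ w (x - p i) - fderiv ℝ w (y - p i)‖ ≤ 4 * r * L := by linarith
        refine h1.trans ?_
        gcongr
      · have hyk : ‖y - p k‖ < r := by
          have : ‖y - p k‖ ≤ ‖x - p k‖ + ‖x - y‖ := by
            have := norm_sub_le (x - p k) (x - y)
            rwa [show x - p k - (x - y) = y - p k by abel] at this
          linarith
        have : (fderiv ℝ w (x - p i) - fderiv ℝ w (y - p i)) (K α (x - y)) = 0 := by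
          by_cases hki : k = i
          · subst hki
            rw [sub_apply, hw.fquad _ (by linarith), hw.fquad _ hyk,
              ← mul_sub, ← inner_sub_left]
            rw [show x - p k - (y - p k) = x - y by abel, K_inner, mul_zero]
          · rw [hw.fzero _ (by linarith [hp.far hki (x := x) (by linarith)]),
              hw.fzero _ (by linarith [hp.far hki (x := y) (by linarith)])]
            simp
        rw [this, abs_zero]; positivity
    have hry : 1 ≤ 4 / r ^ 2 * rho r χ p y := by
      have := rho_out hr h hp y (by positivity : 0 ≤ r / 2) (by linarith) hy
      rw [div_mul_eq_mul_div, le_div_iff₀ (by positivity)]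
      linarith
    rw [hsplit]
    have t1 := abs_sub ((fderiv ℝ w (x - p i) - fderiv ℝ w (y - p i)) (K α (x - y))
      - (∑ j ∈ Finset.univ.erase i, χ (y - p j) * fderiv ℝ w (x - p i) (K α (p i - p j))))
      (∑ j ∈ Finset.univ.erase i, χ (x - p j) * fderiv ℝ w (y - p i) (K α (p i - p j)))
    have t2 := abs_sub ((fderiv ℝ w (x - p i) - fderiv ℝ w (y - p i)) (K α (x - y)))
      (∑ j ∈ Finset.univ.erase i, χ (y - p j) * fderiv ℝ w (x - p i) (K α (p i - p j)))
    have t3 := hQ x y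
    have t4 := hQ y x
    have t5 : (4 * r * L * k0 + 2 * q) * 1 ≤ (4 * r * L * k0 + 2 * q) * (4 / r ^ 2 * rho r χ p y) := by
      gcongr
    rw [hC1, mul_assoc]
    linarith
  have hswap : ∀ x y : E2, ‖x - y‖ = ‖y - x‖ := fun x y => norm_sub_rev x y
  intro x y
  have rx := (hρ x).1
  have ry := (hρ y).1
  have hgoal1 : ∀ c, c ≤ C0 * (rho r χ p x + rho r χ p y) → c ≤ (C0 + C1 + C2) *
      (rho r χ p x + rho r χ p y) + (C0 + C1 + C2) * (rho r χ p x * rho r χ p y * ‖x - y‖ ^ (-α)) := by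
    intro c hc
    have := hpos x y
    have : 0 ≤ (C0 + C1 + C2) * (rho r χ p x * rho r χ p y * ‖x - y‖ ^ (-α)) := by positivity
    have : 0 ≤ (C1 + C2) * (rho r χ p x + rho r χ p y) := by positivity
    linarith
  have hgoal2 : ∀ c, c ≤ C1 * (rho r χ p x + rho r χ p y) → c ≤ (C0 + C1 + C2) *
      (rho r χ p x + rho r χ p y) + (C0 + C1 + C2) * (rho r χ p x * rho r χ p y * ‖x - y‖ ^ (-α)) := by
    intro c hc
    have := hpos x y
    have : 0 ≤ (C0 + C1 + C2) * (rho r χ p x * rho r χ p y * ‖x - y‖ ^ (-α)) := by positivity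
    have : 0 ≤ (C0 + C2) * (rho r χ p x + rho r χ p y) := by positivity
    linarith
  by_cases hx : ∀ l, r / 2 ≤ ‖x - p l‖
  · by_cases hy : ∀ l, r / 2 ≤ ‖y - p l‖
    · have hrx : 1 ≤ 4 / r ^ 2 * rho r χ p x := by
        have := rho_out hr h hp x (by positivity : 0 ≤ r / 2) (by linarith) hx
        rw [div_mul_eq_mul_div, le_div_iff₀ (by positivity)]
        linarith
      have hry : 1 ≤ 4 / r ^ 2 * rho r χ p y := by
        have := rho_out hr h hp y (by positivity : 0 ≤ r / 2) (by linarith) hy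
        rw [div_mul_eq_mul_div, le_div_iff₀ (by positivity)]
        linarith
      have hP : |(fderiv ℝ w (x - p i) - fderiv ℝ w (y - p i)) (K α (x - y))|
          ≤ κ * L * ‖x - y‖ ^ (-α) := by
        have h1 := (fderiv ℝ w (x - p i) - fderiv ℝ w (y - p i)).le_opNorm (K α (x - y))
        have h2 := K_norm α (x - y)
        have h3 := hL1 (x - p i) (y - p i)
        rw [show x - p i - (y - p i) = x - y by abel] at h3
        refine h1.trans ?_
        rcases eq_or_ne x y with rfl | hne
        · simp; positivity
        · have h0 : 0 < ‖x - y‖ := norm_pos_iff.2 (sub_ne_zero.2 hne)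
          have h4 : ‖x - y‖ ^ (-α) = ‖x - y‖ ^ (-(1 + α)) * ‖x - y‖ := by
            rw [show -α = -(1 + α) + 1 by ring, Real.rpow_add h0, Real.rpow_one]
          calc _ ≤ (L * ‖x - y‖) * (κ * ‖x - y‖ ^ (-(1 + α))) := by gcongr
            _ = _ := by rw [h4]; ring
      rw [hsplit]
      have t1 := abs_sub ((fderiv ℝ w (x - p i) - fderiv ℝ w (y - p i)) (K α (x - y))
        - (∑ j ∈ Finset.univ.erase i, χ (y - p j) * fderiv ℝ w (x - p i) (K α (p i - p j))))
        (∑ j ∈ Finset.univ.erase i, χ (x - p j) * fderiv ℝ w (y - p i) (K α (p i - p j)))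
      have t2 := abs_sub ((fderiv ℝ w (x - p i) - fderiv ℝ w (y - p i)) (K α (x - y)))
        (∑ j ∈ Finset.univ.erase i, χ (y - p j) * fderiv ℝ w (x - p i) (K α (p i - p j)))
      have t3 := hQ x y
      have t4 := hQ y x
      have t5 : (2 * q) * 1 ≤ (2 * q) * (4 / r ^ 2 * rho r χ p y) := by gcongr
      have t6 : (2 * q) * (4 / r ^ 2 * rho r χ p y) ≤ C1 * rho r χ p y := by
        rw [show C1 * rho r χ p y = (4 * r * L * k0 + 2 * q) * (4 / r ^ 2 * rho r χ p y) by
          rw [hC1]; ring]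
        refine mul_le_mul_of_nonneg_right ?_ (by positivity)
        have : 0 ≤ 4 * r * L * k0 := by positivity
        linarith
      have t7 : 1 ≤ (4 / r ^ 2 * rho r χ p x) * (4 / r ^ 2 * rho r χ p y) := by nlinarith
      have t8 : κ * L * ‖x - y‖ ^ (-α) ≤ C2 * (rho r χ p x * rho r χ p y * ‖x - y‖ ^ (-α)) := by
        have : κ * L * ‖x - y‖ ^ (-α) * 1 ≤ κ * L * ‖x - y‖ ^ (-α) *
          ((4 / r ^ 2 * rho r χ p x) * (4 / r ^ 2 * rho r χ p y)) := by gcongr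
        rw [mul_one] at this
        refine this.trans (le_of_eq ?_)
        rw [hC2]; field_simp; ring
      have t9 := hpos x y
      have s1 : 0 ≤ (C0 + C1) * (rho r χ p x * rho r χ p y * ‖x - y‖ ^ (-α)) := by positivity
      have s2 : 0 ≤ (C0 + C2) * (rho r χ p x + rho r χ p y) := by positivity
      have s3 : 0 ≤ C1 * rho r χ p x := by positivity
      linarith
    · push Not at hy
      obtain ⟨k, hk⟩ := hy
      rw [add_comm (Aint α w χ p i x y)]
      refine hgoal2 _ ((hmix y x k hk hx).trans ?_)
      have : 0 ≤ C1 * rho r χ p y := by positivity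
      linarith
  · push Not at hx
    obtain ⟨k, hk⟩ := hx
    by_cases hy : ∀ l, r / 2 ≤ ‖y - p l‖
    · refine hgoal2 _ ((hmix x y k hk hy).trans ?_)
      have : 0 ≤ C1 * rho r χ p x := by positivity
      linarith
    · push Not at hy
      obtain ⟨l, hl⟩ := hy
      apply hgoal1
      by_cases hki : k = i
      · subst hki
        by_cases hlk : l = k
        · subst hlk
          have : Aint α w χ p l x y + Aint α w χ p l y x = 0 := by
            rw [hsplit, sub_apply, hw.fquad _ (by linarith),
              hw.fquad _ (by linarith), ← mul_sub, ← inner_sub_left]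
            rw [show x - p l - (y - p l) = x - y by abel, K_inner, mul_zero]
            rw [Finset.sum_eq_zero, Finset.sum_eq_zero, sub_zero, sub_zero]
            · intro j hj
              rw [chi_other hr h hp (i := l) (by simpa [eq_comm] using hj) (by linarith), zero_mul]
            · intro j hj
              rw [chi_other hr h hp (i := l) (by simpa [eq_comm] using hj) (by linarith), zero_mul]
          rw [this, abs_zero]; positivity
        · exact hC0 N p hp hpR k l hlk x y hk hl
      · by_cases hli : l = i
        · subst hli
          rw [add_comm (Aint α w χ p l x y), add_comm (rho r χ p x)]
          exact hC0 N p hp hpR l k hki y x hl hk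
        · have : Aint α w χ p i x y + Aint α w χ p i y x = 0 := by
            rw [hsplit, hw.fzero (x - p i) (by linarith [hp.far hki (x := x) (by linarith)]),
              hw.fzero (y - p i) (by linarith [hp.far hli (x := y) (by linarith)])]
            simp
          rw [this, abs_zero]; positivity


lemma G_ident (α : ℝ) (hα : 0 < α) (hα1 : α < 1) {r lam : ℝ} {χ w : E2 → ℝ}
    (h : Cut r χ) (hw : Adm r w lam) (N : ℕ) (a : Fin N → ℝ) (ϑ : E2 → ℝ) (hc : Continuous ϑ)
    (hs : HasCompactSupport ϑ) (p : Fin N → E2) (i : Fin N) :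
    Integrable (fun z : E2 × E2 => ϑ z.1 * ϑ z.2 * Aint α w χ p i z.1 z.2) (volume.prod volume) ∧
    (∫ x, ϑ x * fderiv ℝ w (x - p i) (vel α ϑ x - ∑ j ∈ Finset.univ.erase i, a j • K α (p i - p j)))
    = (∫ z : E2 × E2, ϑ z.1 * ϑ z.2 * Aint α w χ p i z.1 z.2 ∂(volume.prod volume))
      + ∑ j ∈ Finset.univ.erase i, ((∫ x, ϑ x * χ (x - p j)) - a j) *
        ∫ x, ϑ x * fderiv ℝ w (x - p i) (K α (p i - p j)) := by
  have hDc : Continuous (fderiv ℝ w) := hw.smooth.continuous_fderiv (by norm_num)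
  have hχ := h.smooth.continuous
  set F : E2 → (E2 →L[ℝ] ℝ) := fun x => ϑ x • fderiv ℝ w (x - p i) with hF
  have hFc : Continuous F := by rw [hF]; fun_prop
  have hFs : HasCompactSupport F := hs.smul_right
  have i1 := prod_int_K α hα hα1 ϑ hc hs F hFc hFs
  have j1 : ∀ j, Integrable (fun x => ϑ x * fderiv ℝ w (x - p i) (K α (p i - p j))) := fun j =>
    Continuous.integrable_of_hasCompactSupport (by fun_prop) hs.mul_right
  have j2 : ∀ j, Integrable (fun y => ϑ y * χ (y - p j)) := fun j =>
    Continuous.integrable_of_hasCompactSupport (by fun_prop) hs.mul_right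
  have i2 : ∀ j, Integrable (fun z : E2 × E2 => (ϑ z.1 * fderiv ℝ w (z.1 - p i) (K α (p i - p j))) *
      (ϑ z.2 * χ (z.2 - p j))) (volume.prod volume) := fun j => (j1 j).mul_prod (j2 j)
  have hG : (fun z : E2 × E2 => ϑ z.1 * ϑ z.2 * Aint α w χ p i z.1 z.2) = fun z : E2 × E2 =>
      ϑ z.2 * F z.1 (K α (z.1 - z.2)) - ∑ j ∈ Finset.univ.erase i,
        (ϑ z.1 * fderiv ℝ w (z.1 - p i) (K α (p i - p j))) * (ϑ z.2 * χ (z.2 - p j)) := by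
    ext z
    simp only [Aint, hF, mul_sub, Finset.mul_sum]
    congr 1
    · simp; ring
    · exact Finset.sum_congr rfl fun j _ => by ring
  have hv : ∀ x, ϑ x * fderiv ℝ w (x - p i) (vel α ϑ x) = ∫ y, ϑ y * F x (K α (x - y)) := by
    intro x
    rw [← vel_apply α hα1 ϑ hc hs x (F x)]
    simp [hF]
  have j3 : Integrable (fun x => ϑ x * fderiv ℝ w (x - p i) (vel α ϑ x)) := by
    simp only [hv]
    exact i1.integral_prod_left
  refine ⟨?_, ?_⟩
  · rw [hG]
    exact i1.sub (integrable_finsetSum _ fun j _ => i2 j)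
  · have e1 : (∫ z : E2 × E2, ϑ z.1 * ϑ z.2 * Aint α w χ p i z.1 z.2 ∂(volume.prod volume))
        = (∫ x, ϑ x * fderiv ℝ w (x - p i) (vel α ϑ x)) - ∑ j ∈ Finset.univ.erase i,
          (∫ x, ϑ x * fderiv ℝ w (x - p i) (K α (p i - p j))) * ∫ x, ϑ x * χ (x - p j) := by
      rw [hG, integral_sub i1 (integrable_finsetSum _ fun j _ => i2 j),
        integral_finsetSum _ (fun j _ => i2 j), integral_prod _ i1]
      congr 1
      · exact integral_congr_ae (Filter.Eventually.of_forall fun x => (hv x).symm)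
      · refine Finset.sum_congr rfl fun j _ => ?_
        exact integral_prod_mul (fun x => ϑ x * fderiv ℝ w (x - p i) (K α (p i - p j)))
          (fun y => ϑ y * χ (y - p j))
    have e2 : (∫ x, ϑ x * fderiv ℝ w (x - p i)
        (vel α ϑ x - ∑ j ∈ Finset.univ.erase i, a j • K α (p i - p j)))
        = (∫ x, ϑ x * fderiv ℝ w (x - p i) (vel α ϑ x)) - ∑ j ∈ Finset.univ.erase i,
          a j * ∫ x, ϑ x * fderiv ℝ w (x - p i) (K α (p i - p j)) := by
      have : ∀ x, ϑ x * fderiv ℝ w (x - p i)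
        (vel α ϑ x - ∑ j ∈ Finset.univ.erase i, a j • K α (p i - p j))
        = ϑ x * fderiv ℝ w (x - p i) (vel α ϑ x) - ∑ j ∈ Finset.univ.erase i,
          a j * (ϑ x * fderiv ℝ w (x - p i) (K α (p i - p j))) := by
        intro x
        rw [map_sub, map_sum, mul_sub, Finset.mul_sum]
        congr 1
        refine Finset.sum_congr rfl fun j _ => ?_
        simp; ring
      simp only [this]
      rw [integral_sub j3 (integrable_finsetSum _ fun j _ => (j1 j).const_mul _),
        integral_finsetSum _ (fun j _ => (j1 j).const_mul _)]
      simp only [integral_const_mul]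
    rw [e1, e2, sub_add, ← Finset.sum_sub_distrib]
    congr 1
    exact Finset.sum_congr rfl fun j _ => by ring

lemma static_est (α : ℝ) (hα : 0 < α) (hα1 : α < 1) {r lam : ℝ} (R : ℝ) (hr : 0 < r) {χ w : E2 → ℝ}
    (h : Cut r χ) (hw : Adm r w lam) (N : ℕ) (M : ℝ) (hM : 0 ≤ M) :
    ∃ C : ℝ, 0 ≤ C ∧ ∀ (a : Fin N → ℝ) (ϑ : E2 → ℝ), Continuous ϑ → HasCompactSupport ϑ →
      (∀ x, 0 ≤ ϑ x) → ∀ H, (∀ x, ϑ x ≤ H) → (∫ x, ϑ x) = M → ∀ η, 0 < η →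
      ∀ (p : Fin N → E2), SepPts r p → (∀ i j, ‖p i - p j‖ ≤ R) → ∀ i : Fin N,
      |∫ x, ϑ x * fderiv ℝ w (x - p i)
        (vel α ϑ x - ∑ j ∈ Finset.univ.erase i, a j • K α (p i - p j))|
      ≤ C * ((∫ x, ϑ x * rho r χ p x) + (∫ x, ϑ x * rho r χ p x) *
          (H * η ^ (2 - α) + η ^ (-α) * ∫ x, ϑ x * rho r χ p x)
          + ∑ j, |(∫ x, ϑ x * χ (x - p j)) - a j|) := by
  obtain ⟨C0, hC00, hC0⟩ := pointwise α hα R hr h hw N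
  obtain ⟨I, hI0, hI⟩ := riesz_bound α hα (by linarith)
  obtain ⟨L, hL0, hL1, hL2, hL3⟩ := hw.lip hr
  set k0 := |α * Cconst α| * r ^ (-(1 + α)) with hk0
  have hk00 : 0 ≤ k0 := by positivity
  set c1 := C0 * M
  set c2 := C0 * (4 * r ^ 2 * I + 1)
  set c3 := M * (2 * r * L * k0)
  have hc1 : 0 ≤ c1 := by positivity
  have hc2 : 0 ≤ c2 := by positivity
  have hc3 : 0 ≤ c3 := by positivity
  refine ⟨c1 + c2 + c3, by positivity, ?_⟩
  intro a ϑ hc hs hϑ0 H hϑH hϑM η hη p hp hpR i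
  obtain ⟨hGi, hGe⟩ := G_ident α hα hα1 h hw N a ϑ hc hs p i
  rw [hGe]
  have hρc := rho_cont h p
  have hρ := rho_bd hr h hp
  set Φ := ∫ x, ϑ x * rho r χ p x with hΦ
  set g : E2 → ℝ := fun x => ϑ x * rho r χ p x with hg
  have hg0 : ∀ x, 0 ≤ g x := fun x => mul_nonneg (hϑ0 x) (hρ x).1
  have hΦ0 : 0 ≤ Φ := integral_nonneg hg0
  have hH : 0 ≤ H := (hϑ0 0).trans (hϑH 0)
  have hϑi : Integrable ϑ := hc.integrable_of_hasCompactSupport hs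
  have hgc : Continuous g := by rw [hg]; fun_prop
  have hgi : Integrable g := hgc.integrable_of_hasCompactSupport hs.mul_right
  have hgH : ∀ x, g x ≤ 4 * r ^ 2 * H := by
    intro x
    rw [hg, mul_comm (4 * r ^ 2)]
    exact mul_le_mul (hϑH x) (hρ x).2 (hρ x).1 hH
  -- the symmetrised integral
  have hrz : Integrable (fun z : E2 × E2 => g z.1 * g z.2 * ‖z.1 - z.2‖ ^ (-α))
      (volume.prod volume) :=
    prod_int α hα (by linarith) g g hgi (4 * r ^ 2 * H)
      (fun x => by rw [abs_of_nonneg (hg0 x)]; exact hgH x) hgi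
  have hrzb : (∫ z : E2 × E2, g z.1 * g z.2 * ‖z.1 - z.2‖ ^ (-α) ∂(volume.prod volume))
      ≤ Φ * (4 * r ^ 2 * H * (η ^ (2 - α) * I) + η ^ (-α) * Φ) := by
    rw [integral_prod _ hrz]
    rw [hΦ, ← integral_mul_const]
    refine integral_mono hrz.integral_prod_left (hgi.mul_const _) fun x => ?_
    simp only [mul_assoc (g x), integral_const_mul]
    refine mul_le_mul_of_nonneg_left ?_ (hg0 x)
    exact hI g (4 * r ^ 2 * H) η hη hg0 hgH hgi x
  have hS : |∫ z : E2 × E2, ϑ z.1 * ϑ z.2 * Aint α w χ p i z.1 z.2 ∂(volume.prod volume)|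
      ≤ C0 * M * Φ + C0 * (Φ * (4 * r ^ 2 * H * (η ^ (2 - α) * I) + η ^ (-α) * Φ)) := by
    set G : E2 × E2 → ℝ := fun z => ϑ z.1 * ϑ z.2 * Aint α w χ p i z.1 z.2 with hGd
    have hsw : (∫ z, G z ∂(volume.prod volume)) = ∫ z : E2 × E2, G z.swap ∂(volume.prod volume) :=
      (integral_prod_swap G).symm
    have hswi : Integrable (fun z : E2 × E2 => G z.swap) (volume.prod volume) := hGi.swap
    have h2 : 2 * (∫ z, G z ∂(volume.prod volume))
        = ∫ z : E2 × E2, (G z + G z.swap) ∂(volume.prod volume) := by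
      rw [integral_add hGi hswi, ← hsw]; ring
    have m1 : Integrable (fun z : E2 × E2 => g z.1 * ϑ z.2) (volume.prod volume) :=
      hgi.mul_prod hϑi
    have m2 : Integrable (fun z : E2 × E2 => ϑ z.1 * g z.2) (volume.prod volume) :=
      hϑi.mul_prod hgi
    have v1 : (∫ z : E2 × E2, g z.1 * ϑ z.2 ∂(volume.prod volume)) = Φ * M := by
      rw [← hϑM]; exact integral_prod_mul g ϑ
    have v2 : (∫ z : E2 × E2, ϑ z.1 * g z.2 ∂(volume.prod volume)) = M * Φ := by
      rw [← hϑM]; exact integral_prod_mul ϑ g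
    have hb : ‖∫ z : E2 × E2, (G z + G z.swap) ∂(volume.prod volume)‖ ≤
        ∫ z : E2 × E2, (C0 * (g z.1 * ϑ z.2 + ϑ z.1 * g z.2)
          + C0 * (g z.1 * g z.2 * ‖z.1 - z.2‖ ^ (-α))) ∂(volume.prod volume) := by
      refine norm_integral_le_of_norm_le (((m1.add m2).const_mul C0).add (hrz.const_mul C0))
        (Filter.Eventually.of_forall fun z => ?_)
      have hpt := hC0 p hp hpR i z.1 z.2
      have e : G z + G z.swap = (ϑ z.1 * ϑ z.2) *
          (Aint α w χ p i z.1 z.2 + Aint α w χ p i z.2 z.1) := by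
        simp only [hGd, Prod.fst_swap, Prod.snd_swap]; ring
      have hpos : 0 ≤ ϑ z.1 * ϑ z.2 := mul_nonneg (hϑ0 _) (hϑ0 _)
      rw [e, norm_mul, Real.norm_eq_abs, Real.norm_eq_abs, abs_of_nonneg hpos]
      refine (mul_le_mul_of_nonneg_left hpt hpos).trans (le_of_eq ?_)
      simp only [hg]; ring
    have m3 : Integrable (fun z : E2 × E2 => C0 * (g z.1 * ϑ z.2 + ϑ z.1 * g z.2))
      (volume.prod volume) := (m1.add m2).const_mul C0
    rw [integral_add m3 (hrz.const_mul C0), integral_const_mul,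
      integral_const_mul, integral_add m1 m2, v1, v2, ← h2, Real.norm_eq_abs, abs_mul,
      abs_of_pos (by norm_num : (0:ℝ) < 2)] at hb
    have := mul_le_mul_of_nonneg_left hrzb hC00
    have hP : 0 ≤ C0 * (Φ * (4 * r ^ 2 * H * (η ^ (2 - α) * I) + η ^ (-α) * Φ)) := by positivity
    nlinarith
  have hE : |∑ j ∈ Finset.univ.erase i, ((∫ x, ϑ x * χ (x - p j)) - a j) *
        ∫ x, ϑ x * fderiv ℝ w (x - p i) (K α (p i - p j))|
      ≤ c3 * ∑ j, |(∫ x, ϑ x * χ (x - p j)) - a j| := by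
    refine (Finset.abs_sum_le_sum_abs _ _).trans ?_
    rw [Finset.mul_sum]
    refine (Finset.sum_le_sum (g := fun j => c3 * |(∫ x, ϑ x * χ (x - p j)) - a j|) ?_).trans
      (Finset.sum_le_sum_of_subset_of_nonneg (Finset.subset_univ _) fun j _ _ => by positivity)
    intro j hj
    have hij : i ≠ j := by simpa [eq_comm] using hj
    rw [abs_mul, mul_comm]
    refine mul_le_mul_of_nonneg_right ?_ (abs_nonneg _)
    have : ‖∫ x, ϑ x * fderiv ℝ w (x - p i) (K α (p i - p j))‖
        ≤ ∫ x, ϑ x * (2 * r * L * k0) := by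
      refine norm_integral_le_of_norm_le (hϑi.mul_const _) (Filter.Eventually.of_forall fun x => ?_)
      rw [norm_mul, Real.norm_eq_abs, abs_of_nonneg (hϑ0 x)]
      refine mul_le_mul_of_nonneg_left ?_ (hϑ0 x)
      refine ((fderiv ℝ w (x - p i)).le_opNorm _).trans ?_
      have h2 := K_norm_le α hα hr (p i - p j) (by linarith [hp i j hij])
      have h3 := hL3 (x - p i)
      gcongr
    rwa [integral_mul_const, hϑM, Real.norm_eq_abs] at this
  refine (abs_add_le _ _).trans ?_
  set S := ∑ j, |(∫ x, ϑ x * χ (x - p j)) - a j|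
  have hS0 : 0 ≤ S := Finset.sum_nonneg fun _ _ => abs_nonneg _
  set u := η ^ (2 - α)
  set v := η ^ (-α)
  have hu : 0 ≤ u := by positivity
  have hv : 0 ≤ v := by positivity
  have q1 : C0 * (Φ * (4 * r ^ 2 * H * (u * I) + v * Φ)) ≤ c2 * (Φ * (H * u + v * Φ)) := by
    have z1 : 0 ≤ C0 * (Φ * (4 * r ^ 2 * I * (v * Φ))) := by positivity
    have z2 : 0 ≤ C0 * (Φ * (H * u)) := by positivity
    calc _ ≤ C0 * (Φ * (4 * r ^ 2 * H * (u * I) + v * Φ)) + C0 * (Φ * (4 * r ^ 2 * I * (v * Φ)))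
          + C0 * (Φ * (H * u)) := by linarith
      _ = _ := by simp only [c2]; ring
  have z1 : 0 ≤ c1 * (Φ * (H * u + v * Φ) + S) := by positivity
  have z2 : 0 ≤ c2 * (Φ + S) := by positivity
  have z3 : 0 ≤ c3 * (Φ + Φ * (H * u + v * Φ)) := by positivity
  have q2 : C0 * M * Φ = c1 * Φ := rfl
  linarith

lemma time_deriv (α : ℝ) (hα : 0 < α) (hα1 : α < 1) (θ : ℝ → E2 → ℝ)
    (hθ : ContDiff ℝ 1 (fun q : ℝ × E2 => θ q.1 q.2)) (w : E2 → ℝ) (hw : ContDiff ℝ 1 w)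
    (hws : HasCompactSupport w) (y y' : ℝ → E2) (hy'c : Continuous y')
    (hy : ∀ t, HasDerivAt y (y' t) t) (t : ℝ) (hs : HasCompactSupport (θ t))
    (hPDE : ∀ p, deriv (fun s : ℝ => θ s p) t + ⟪vel α (θ t) p, gradient (θ t) p⟫ = 0) :
    HasDerivAt (fun s => ∫ x, θ s x * w (x - y s))
      (∫ x, θ t x * fderiv ℝ w (x - y t) (vel α (θ t) x - y' t)) t := by
  set Θ : ℝ × E2 → ℝ := fun q => θ q.1 q.2 with hΘ
  have hyc : Continuous y := continuous_iff_continuousAt.2 fun t => (hy t).continuousAt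
  have hΘd : ∀ q, HasFDerivAt Θ (fderiv ℝ Θ q) q := fun q =>
    ((hθ.differentiable (by norm_num)) q).hasFDerivAt
  have hΘc : Continuous (fderiv ℝ Θ) := hθ.continuous_fderiv (by norm_num)
  have hΘc0 : Continuous Θ := hθ.continuous
  have hwc := hw.continuous
  -- the substituted integral
  have hsub : ∀ s, (∫ x, θ s x * w (x - y s)) = ∫ z, Θ (s, z + y s) * w z := by
    intro s
    rw [← integral_add_right_eq_self _ (y s)]
    simp [hΘ]
  simp only [hsub]
  set D : ℝ → E2 → ℝ := fun s z => fderiv ℝ Θ (s, z + y s) (1, y' s) with hD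
  have hDc : Continuous (fun q : ℝ × E2 => D q.1 q.2) := by
    rw [hD]; fun_prop
  obtain ⟨B, hB⟩ := ((isCompact_Icc (a := t - 1) (b := t + 1)).prod hws.isCompact).exists_bound_of_continuousOn
    hDc.continuousOn
  have hwi : Integrable w := hwc.integrable_of_hasCompactSupport hws
  have hFd : ∀ s z, HasDerivAt (fun s => Θ (s, z + y s) * w z) (D s z * w z) s := by
    intro s z
    refine HasDerivAt.mul_const ?_ _
    have h1 : HasDerivAt (fun s => (s, z + y s)) ((1 : ℝ), y' s) s :=
      (hasDerivAt_id s).prodMk ((hy s).const_add z)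
    exact (hΘd (s, z + y s)).comp_hasDerivAt s h1
  have key := (hasDerivAt_integral_of_dominated_loc_of_deriv_le (μ := volume)
    (F := fun s z => Θ (s, z + y s) * w z) (F' := fun s z => D s z * w z)
    (bound := fun z => B * ‖w z‖) (x₀ := t) (s := Set.Icc (t - 1) (t + 1))
    (Icc_mem_nhds (by linarith) (by linarith))
    (Filter.Eventually.of_forall fun s => Continuous.aestronglyMeasurable (by fun_prop))
    (Continuous.integrable_of_hasCompactSupport (by fun_prop) hws.mul_left)
    (Continuous.aestronglyMeasurable (by
      have : Continuous (fun z => D t z) := hDc.comp (by fun_prop : Continuous fun z : E2 => (t, z))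
      fun_prop))
    (Filter.Eventually.of_forall fun z s hsm => by
      by_cases hz : z ∈ tsupport w
      · rw [norm_mul]
        exact mul_le_mul_of_nonneg_right (hB (s, z) ⟨hsm, hz⟩) (norm_nonneg _)
      · rw [image_eq_zero_of_notMem_tsupport hz]; simp)
    (hwi.norm.const_mul B)
    (Filter.Eventually.of_forall fun z s _ => hFd s z)).2
  suffices hval : (∫ x, θ t x * fderiv ℝ w (x - y t) (vel α (θ t) x - y' t)) = ∫ z, D t z * w z by
    rw [hval]; exact key
  -- identify the derivative
  have hθt : ContDiff ℝ 1 (θ t) := hθ.comp (contDiff_const.prodMk contDiff_id)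
  have e1 : (∫ z, D t z * w z) = ∫ x, w (x - y t) * fderiv ℝ Θ (t, x) (1, y' t) := by
    rw [← integral_add_right_eq_self (fun x => w (x - y t) * fderiv ℝ Θ (t, x) (1, y' t)) (y t)]
    simp [hD, mul_comm]
  have e2 : ∀ x, fderiv ℝ Θ (t, x) (1, y' t) = - fderiv ℝ (θ t) x (vel α (θ t) x - y' t) := by
    intro x
    have d1 : HasDerivAt (fun s => θ s x) (fderiv ℝ Θ (t, x) (1, 0)) t := by
      have h1 : HasDerivAt (fun s : ℝ => (s, x)) ((1 : ℝ), (0 : E2)) t :=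
        (hasDerivAt_id t).prodMk (hasDerivAt_const t x)
      exact (hΘd (t, x)).comp_hasDerivAt t h1
    have d2 : HasFDerivAt (θ t) ((fderiv ℝ Θ (t, x)).comp (ContinuousLinearMap.inr ℝ ℝ E2)) x :=
      (hΘd (t, x)).comp x (hasFDerivAt_prodMk_right t x)
    have h3 := hPDE x
    rw [inner_gradient_right, d1.deriv] at h3
    have h4 : ∀ v, fderiv ℝ Θ (t, x) (0, v) = fderiv ℝ (θ t) x v := by
      intro v; rw [d2.fderiv]; simp
    have h5 : ((1 : ℝ), y' t) = (1, 0) + (0, y' t) := by simp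
    rw [h5, map_add, h4, map_sub]
    simp at h3
    linarith
  have e3 := transport_ibp α hα hα1 (θ t) hθt hs (fun x => w (x - y t)) (by fun_prop)
    (hws.comp_homeomorph (Homeomorph.subRight (y t))) (y' t)
  rw [e1]
  simp only [e2, mul_neg, integral_neg]
  rw [e3, neg_neg]
  simp only [fderiv_comp_sub]

lemma vortex_ext (α : ℝ) {N : ℕ} (a : Fin N → ℝ) (x0 : Fin N → E2) (T : ℝ) (hT : 0 < T)
    (x : ℝ → Fin N → E2) (hx : IsPVSol α a x0 T x) :
    ∃ y y' : ℝ → Fin N → E2, (∀ i, Continuous fun t => y' t i) ∧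
      (∀ i t, HasDerivAt (fun s => y s i) (y' t i) t) ∧
      (∀ t ∈ Set.Icc 0 T, y t = x t) ∧
      (∀ t ∈ Set.Icc 0 T, ∀ i, y' t i = ∑ j ∈ Finset.univ.erase i, a j • K α (y t i - y t j)) := by
  obtain ⟨hc, hne, heq⟩ := hx
  set X : ℝ → Fin N → E2 := Set.IccExtend hT.le (Set.domRestrict (Set.Icc 0 T) x) with hX
  have hXc : Continuous X := (continuousOn_iff_continuous_domRestrict.1 hc).Icc_extend'
  have hXe : ∀ t ∈ Set.Icc 0 T, X t = x t := fun t ht => by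
    rw [hX, Set.IccExtend_of_mem hT.le _ ht]; rfl
  have hXne : ∀ t i j, i ≠ j → X t i - X t j ≠ 0 := fun t i j hij =>
    sub_ne_zero.2 (hne _ (Set.projIcc 0 T hT.le t).2 i j hij)
  have hKc : ∀ i j, i ≠ j → Continuous fun t => K α (X t i - X t j) := by
    intro i j hij
    refine continuous_iff_continuousAt.2 fun t => ?_
    refine ContinuousAt.comp (g := K α) (K_contAt α _ (hXne t i j hij)) ?_
    have : Continuous fun t => X t i - X t j := by fun_prop
    exact this.continuousAt
  have hye : ∀ t ∈ Set.Icc 0 T, (fun i => x0 i + ∑ j ∈ Finset.univ.erase i,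
      a j • ∫ s in (0:ℝ)..t, K α (X s i - X s j)) = x t := by
    intro t ht
    ext1 i
    rw [heq i t ht]
    congr 1
    refine Finset.sum_congr rfl fun j _ => ?_
    congr 1
    refine intervalIntegral.integral_congr fun s hs => ?_
    rw [Set.uIcc_of_le ht.1] at hs
    simp only [hXe s ⟨hs.1, hs.2.trans ht.2⟩]
  refine ⟨fun t i => x0 i + ∑ j ∈ Finset.univ.erase i, a j • ∫ s in (0:ℝ)..t, K α (X s i - X s j),
    fun t i => ∑ j ∈ Finset.univ.erase i, a j • K α (X t i - X t j), ?_, ?_, hye, ?_⟩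
  · intro i
    refine continuous_finsetSum _ fun j hj => ?_
    exact (hKc i j (by simpa [eq_comm] using hj)).const_smul (a j)
  · intro i t
    refine HasDerivAt.const_add _ (HasDerivAt.fun_sum fun j hj => HasDerivAt.fun_const_smul (a j) ?_)
    have := hKc i j (by simpa [eq_comm] using hj)
    exact intervalIntegral.integral_hasDerivAt_right (this.intervalIntegrable _ _)
      (this.stronglyMeasurableAtFilter _ _) this.continuousAt
  · intro t ht i
    have h1 := hye t ht
    refine Finset.sum_congr rfl fun j _ => ?_
    have e1 := congrFun h1 i
    have e2 := congrFun h1 j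
    simp only at e1 e2 ⊢
    rw [e1, e2, hXe t ht]

lemma sep_radius {N : ℕ} (T : ℝ) (y : ℝ → Fin N → E2) (hy : ∀ i, Continuous fun t => y t i)
    (hne : ∀ t ∈ Set.Icc (0:ℝ) T, ∀ i j : Fin N, i ≠ j → y t i ≠ y t j) :
    ∃ r > 0, ∃ R : ℝ, ∀ t ∈ Set.Icc (0:ℝ) T, SepPts r (y t) ∧ ∀ i j, ‖y t i - y t j‖ ≤ R := by
  have h1 : ∀ᶠ r in nhdsWithin (0:ℝ) (Set.Ioi 0), ∀ i j, i ≠ j → ∀ t ∈ Set.Icc (0:ℝ) T,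
      8 * r ≤ ‖y t i - y t j‖ := by
    rw [Filter.eventually_all]; intro i
    rw [Filter.eventually_all]; intro j
    by_cases hij : i = j
    · simp [hij]
    have hc : ContinuousOn (fun t => ‖y t i - y t j‖) (Set.Icc (0:ℝ) T) :=
      ((hy i).sub (hy j)).norm.continuousOn
    obtain ⟨m, hm, hmb⟩ := isCompact_Icc.exists_forall_le' hc (a := 0)
      (fun t ht => norm_pos_iff.2 (sub_ne_zero.2 (hne t ht i j hij)))
    have : ∀ᶠ r in nhdsWithin (0:ℝ) (Set.Ioi 0), r < m / 8 :=
      nhdsWithin_le_nhds (eventually_lt_nhds (by positivity))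
    filter_upwards [this] with r hr _ t ht
    have := hmb t ht
    linarith
  have h2 : ∀ᶠ R in Filter.atTop, ∀ i j, ∀ t ∈ Set.Icc (0:ℝ) T, ‖y t i - y t j‖ ≤ R := by
    rw [Filter.eventually_all]; intro i
    rw [Filter.eventually_all]; intro j
    have hc : ContinuousOn (fun t => y t i - y t j) (Set.Icc (0:ℝ) T) :=
      ((hy i).sub (hy j)).continuousOn
    obtain ⟨B, hB⟩ := isCompact_Icc.exists_bound_of_continuousOn hc
    filter_upwards [Filter.eventually_ge_atTop B] with R hR t ht using (hB t ht).trans hR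
  obtain ⟨r, hr, hr0⟩ := (h1.and self_mem_nhdsWithin).exists
  obtain ⟨R, hR⟩ := h2.exists
  exact ⟨r, hr0, R, fun t ht => ⟨fun i j hij => hr i j hij t ht, fun i j => hR i j t ht⟩⟩

lemma phi_eq {r : ℝ} {χ : E2 → ℝ} (h : Cut r χ) {N : ℕ} (a : Fin N → ℝ) (p : Fin N → E2)
    (ϑ : E2 → ℝ) (hc : Continuous ϑ) (hs : HasCompactSupport ϑ) (hm : (∫ x, ϑ x) = ∑ i, a i) :
    (∫ x, ϑ x * rho r χ p x) = ∑ i, (4 * r ^ 2 * a i -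
      ∫ x, ϑ x * (χ (x - p i) * (4 * r ^ 2 - ‖x - p i‖ ^ 2))) := by
  have hχ := h.smooth.continuous
  have hi : ∀ i, Integrable (fun x => ϑ x * (χ (x - p i) * (4 * r ^ 2 - ‖x - p i‖ ^ 2))) := fun i =>
    Continuous.integrable_of_hasCompactSupport (by fun_prop) hs.mul_right
  have hϑi : Integrable ϑ := hc.integrable_of_hasCompactSupport hs
  simp only [rho, mul_sub (ϑ _) (4 * r ^ 2) (∑ i, _), Finset.mul_sum]
  rw [integral_sub (hϑi.mul_const _) (integrable_finsetSum _ fun i _ => hi i),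
    integral_finsetSum _ (fun i _ => hi i), integral_mul_const, hm, Finset.sum_sub_distrib,
    ← Finset.mul_sum, mul_comm]

lemma init_est {r lam s : ℝ} (hr : 0 < r) {w : E2 → ℝ} (hw : Adm r w lam) {N : ℕ} (a : Fin N → ℝ)
    (p : Fin N → E2) (hp : SepPts r p) (g : Fin N → E2 → ℝ) (hgc : ∀ i, Continuous (g i))
    (hgs : ∀ i, HasCompactSupport (g i)) (hg0 : ∀ i x, 0 ≤ g i x) (hgm : ∀ i, (∫ x, g i x) = a i)
    (hgp : ∀ i x, g i x ≠ 0 → ‖x - p i‖ ≤ s) (hsr : s ≤ r) (i : Fin N) :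
    |(∫ x, (∑ j, g j x) * w (x - p i)) - a i * w 0| ≤ |lam| * s ^ 2 * a i := by
  have hwc := hw.smooth.continuous
  have e : ∀ x, (∑ j, g j x) * w (x - p i) = g i x * w (x - p i) := by
    intro x
    rw [Finset.sum_mul, Finset.sum_eq_single i]
    · intro j _ hj
      by_cases h0 : g j x = 0
      · simp [h0]
      · have := hgp j x h0
        rw [hw.zero _ (by linarith [hp.far hj (x := x) (by linarith)]), mul_zero]
    · simp
  have gi : Integrable (g i) := (hgc i).integrable_of_hasCompactSupport (hgs i)
  have i1 : Integrable (fun x => g i x * w (x - p i)) := by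
    have := hgc i
    exact Continuous.integrable_of_hasCompactSupport (by fun_prop) (hgs i).mul_right
  simp only [e]
  rw [← hgm i, ← integral_mul_const, ← integral_sub i1 (gi.mul_const _), ← Real.norm_eq_abs,
    ← integral_const_mul]
  refine norm_integral_le_of_norm_le (gi.const_mul _) (Filter.Eventually.of_forall fun x => ?_)
  by_cases h0 : g i x = 0
  · simp [h0]
  · have h1 := hgp i x h0
    rw [hw.quad _ (h1.trans hsr), ← mul_sub, norm_mul, Real.norm_eq_abs, abs_of_nonneg (hg0 i x),
      mul_comm]
    refine mul_le_mul_of_nonneg_right ?_ (hg0 i x)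
    rw [sub_sub_cancel_left, norm_neg, norm_mul, norm_pow, norm_norm, Real.norm_eq_abs]
    gcongr

lemma small_eps (α : ℝ) (hα1 : α < 1) (Q : ℝ) (hQ : 0 ≤ Q) : ∃ ε1 : ℝ, 0 < ε1 ∧
    ∀ ε, 0 < ε → ε ≤ ε1 → ε ≤ 1 → Q * (ε ^ 2) ^ (1 - α) ≤ 1 := by
  have hb : 0 < 1 - α := by linarith
  refine ⟨(1 / (Q + 1)) ^ (1 / (1 - α)), by positivity, ?_⟩
  intro ε h0 h1 h2
  have e1 : (ε ^ 2) ^ (1 - α) ≤ 1 / (Q + 1) := by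
    calc (ε ^ 2) ^ (1 - α) ≤ ε ^ (1 - α) := by
          apply Real.rpow_le_rpow (by positivity) (by nlinarith) hb.le
      _ ≤ ((1 / (Q + 1)) ^ (1 / (1 - α))) ^ (1 - α) := Real.rpow_le_rpow h0.le h1 hb.le
      _ = 1 / (Q + 1) := by
          rw [← Real.rpow_mul (by positivity), one_div_mul_cancel hb.ne', Real.rpow_one]
  calc Q * (ε ^ 2) ^ (1 - α) ≤ Q * (1 / (Q + 1)) := by gcongr
    _ ≤ 1 := by rw [mul_one_div, div_le_one (by positivity)]; linarith

lemma concentration (α : ℝ) (hα : 0 < α) (hα1 : α < 1) (N : ℕ) (T : ℝ) (hT : 0 < T)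
    (a : Fin N → ℝ) (ha : ∀ i, 0 < a i) {r R : ℝ} (hr : 0 < r) {χ : E2 → ℝ} (h : Cut r χ)
    (y y' : ℝ → Fin N → E2) (hy'c : ∀ i, Continuous fun t => y' t i)
    (hyd : ∀ i t, HasDerivAt (fun s => y s i) (y' t i) t)
    (hyp : ∀ t ∈ Set.Icc (0:ℝ) T, SepPts r (y t) ∧ ∀ i j, ‖y t i - y t j‖ ≤ R)
    (hy' : ∀ t ∈ Set.Icc 0 T, ∀ i, y' t i = ∑ j ∈ Finset.univ.erase i, a j • K α (y t i - y t j))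
    (C1 C2 : ℝ) (hC1 : 0 < C1) (hC2 : 0 < C2) :
    ∃ C : ℝ, 0 ≤ C ∧ ∃ ε1 : ℝ, 0 < ε1 ∧ ∀ ε, 0 < ε → ε ≤ ε1 → ε ≤ 1 → ∀ θ : ℝ → E2 → ℝ,
      ContDiff ℝ 1 (fun q : ℝ × E2 => θ q.1 q.2) →
      (∀ t ∈ Set.Icc (0:ℝ) T, HasCompactSupport (θ t)) →
      (∀ t ∈ Set.Icc (0:ℝ) T, ∀ p, 0 ≤ θ t p ∧ θ t p ≤ C2 / ε ^ 2) →
      (∀ t ∈ Set.Icc (0:ℝ) T, (∫ p, θ t p) = ∑ i, a i) →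
      (∀ t ∈ Set.Icc (0:ℝ) T, ∀ p,
        deriv (fun s : ℝ => θ s p) t + ⟪vel α (θ t) p, gradient (θ t) p⟫ = 0) →
      ∀ g : Fin N → E2 → ℝ, (∀ i, Continuous (g i)) → (∀ i, HasCompactSupport (g i)) →
      (∀ i x, 0 ≤ g i x) → (∀ i, (∫ x, g i x) = a i) →
      (∀ i x, g i x ≠ 0 → ‖x - y 0 i‖ ≤ C1 * ε) → (∀ x, θ 0 x = ∑ j, g j x) →
      ∀ t ∈ Set.Icc (0:ℝ) T, (∀ i, |(∫ x, θ t x * χ (x - y t i)) - a i| ≤ C * ε ^ 2) ∧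
        (∫ x, θ t x * rho r χ (y t) x) ≤ C * ε ^ 2 := by
  set M := ∑ i, a i with hM
  have hM0 : 0 ≤ M := Finset.sum_nonneg fun i _ => (ha i).le
  set ψ : E2 → ℝ := fun z => χ z * (4 * r ^ 2 - ‖z‖ ^ 2) with hψ
  have hAχ := h.adm hr
  have hAψ : Adm r ψ 1 := h.adm2 hr
  have hψ0 : ψ 0 = 4 * r ^ 2 := by simp [hψ, h.one 0 (by simpa using hr.le)]
  have hχ0 : χ 0 = 1 := h.one 0 (by simpa using hr.le)
  obtain ⟨Cχ, hCχ0, hCχ⟩ := static_est α hα hα1 R hr h hAχ N M hM0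
  obtain ⟨Cψ, hCψ0, hCψ⟩ := static_est α hα hα1 R hr h hAψ N M hM0
  set C0 := Cχ + Cψ with hC0
  have hC00 : 0 ≤ C0 := by positivity
  set κ := C0 * N * (3 + C2) + 1 with hκ
  have hκ0 : 0 < κ := by positivity
  set c := C1 ^ 2 * M + 1 with hc
  have hc0 : 0 < c := by positivity
  set Eb := c * Real.exp (κ * T) with hEb
  have hEb0 : 0 < Eb := by positivity
  obtain ⟨ε2, hε20, hε2⟩ := small_eps α hα1 (N * Eb) (by positivity)
  refine ⟨(N + 1) * Eb, by positivity, min ε2 (r / C1), by positivity, ?_⟩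
  intro ε hε0 hεm hε1' θ hθ hs hb hm hPDE g hgc hgs hg0 hgm hgp hinit
  have hεs := hε2 ε hε0 (hεm.trans (min_le_left _ _)) hε1'
  have hC1ε : C1 * ε ≤ r := by
    have := hεm.trans (min_le_right _ _)
    rw [le_div_iff₀ hC1] at this
    linarith
  have hθc : ∀ t, Continuous (θ t) := fun t => hθ.continuous.comp (by fun_prop : Continuous fun z : E2 => (t, z))
  set V : ℝ → Fin N → ℝ × ℝ := fun t i =>
    ((∫ x, θ t x * ψ (x - y t i)) - a i * ψ 0, (∫ x, θ t x * χ (x - y t i)) - a i * χ 0) with hV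
  set V' : ℝ → Fin N → ℝ × ℝ := fun t i =>
    (∫ x, θ t x * fderiv ℝ ψ (x - y t i) (vel α (θ t) x - y' t i),
      ∫ x, θ t x * fderiv ℝ χ (x - y t i) (vel α (θ t) x - y' t i)) with hV'
  have hVd : ∀ t ∈ Set.Icc (0:ℝ) T, HasDerivAt V (V' t) t := by
    intro t ht
    refine hasDerivAt_pi.2 fun i => HasDerivAt.prodMk ?_ ?_
    · exact (time_deriv α hα hα1 θ hθ ψ (hAψ.smooth.of_le (by norm_num)) hAψ.hcs
        (fun s => y s i) (fun s => y' s i) (hy'c i) (hyd i) t (hs t ht) (hPDE t ht)).sub_const _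
    · exact (time_deriv α hα hα1 θ hθ χ (hAχ.smooth.of_le (by norm_num)) hAχ.hcs
        (fun s => y s i) (fun s => y' s i) (hy'c i) (hyd i) t (hs t ht) (hPDE t ht)).sub_const _
  have hV1 : ∀ t i, |(∫ x, θ t x * ψ (x - y t i)) - a i * ψ 0| ≤ ‖V t‖ := fun t i =>
    (norm_fst_le (V t i)).trans (norm_le_pi_norm (V t) i)
  have hV2 : ∀ t i, |(∫ x, θ t x * χ (x - y t i)) - a i| ≤ ‖V t‖ := fun t i => by
    have := (norm_snd_le (V t i)).trans (norm_le_pi_norm (V t) i)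
    simpa [hV, hχ0] using this
  have hΦ : ∀ t ∈ Set.Icc (0:ℝ) T, (∫ x, θ t x * rho r χ (y t) x) ≤ N * ‖V t‖ := by
    intro t ht
    rw [phi_eq h a (y t) (θ t) (hθc t) (hs t ht) (hm t ht)]
    refine (Finset.sum_le_card_nsmul _ _ ‖V t‖ fun i _ => ?_).trans (le_of_eq (by simp))
    have := (neg_le_abs _).trans (hV1 t i)
    rw [hψ0] at this
    simp only [hψ] at this
    linarith
  have hS : ∀ t, (∑ j, |(∫ x, θ t x * χ (x - y t j)) - a j|) ≤ N * ‖V t‖ := by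
    intro t
    exact (Finset.sum_le_card_nsmul _ _ ‖V t‖ fun i _ => hV2 t i).trans (le_of_eq (by simp))
  have hεε : 0 < ε ^ 2 := by positivity
  have hp1 : (ε ^ 2) ^ (2 - α) = (ε ^ 2) ^ (1 - α) * ε ^ 2 := by
    rw [show 2 - α = (1 - α) + 1 by ring, Real.rpow_add hεε, Real.rpow_one]
  have hp2 : (ε ^ 2) ^ (1 - α) = (ε ^ 2) ^ (-α) * ε ^ 2 := by
    rw [show 1 - α = -α + 1 by ring, Real.rpow_add hεε, Real.rpow_one]
  have hp3 : (ε ^ 2) ^ (1 - α) ≤ 1 :=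
    Real.rpow_le_one hεε.le (by nlinarith) (by linarith)
  have hp4 : C2 / ε ^ 2 * (ε ^ 2) ^ (2 - α) ≤ C2 := by
    rw [hp1]
    calc C2 / ε ^ 2 * ((ε ^ 2) ^ (1 - α) * ε ^ 2) = C2 * (ε ^ 2) ^ (1 - α) := by field_simp
      _ ≤ C2 * 1 := by gcongr
      _ = C2 := mul_one _
  -- bound of the derivative
  have hVb : ∀ t ∈ Set.Icc (0:ℝ) T, ‖V t‖ ≤ Eb * ε ^ 2 →
      ‖V' t‖ ≤ C0 * N * (3 + C2) * ‖V t‖ := by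
    intro t ht hVt
    set Φ := ∫ x, θ t x * rho r χ (y t) x with hΦd
    have hΦ0 : 0 ≤ Φ := integral_nonneg fun x =>
      mul_nonneg (hb t ht x).1 (rho_bd hr h (hyp t ht).1 x).1
    have hΦt := hΦ t ht
    have hSt := hS t
    set S := ∑ j, |(∫ x, θ t x * χ (x - y t j)) - a j| with hSd
    have hv0 : 0 ≤ ‖V t‖ := norm_nonneg _
    have q1 : (ε ^ 2) ^ (-α) * Φ ≤ 1 := by
      calc (ε ^ 2) ^ (-α) * Φ ≤ (ε ^ 2) ^ (-α) * (N * (Eb * ε ^ 2)) := by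
            gcongr
            exact hΦt.trans (by gcongr)
        _ = N * Eb * (ε ^ 2) ^ (1 - α) := by rw [hp2]; ring
        _ ≤ 1 := hεs
    have q2 : Φ + Φ * (C2 / ε ^ 2 * (ε ^ 2) ^ (2 - α) + (ε ^ 2) ^ (-α) * Φ) + S
        ≤ N * (3 + C2) * ‖V t‖ := by
      have : Φ * (C2 / ε ^ 2 * (ε ^ 2) ^ (2 - α) + (ε ^ 2) ^ (-α) * Φ) ≤ N * ‖V t‖ * (C2 + 1) := by
        gcongr
      linarith
    have gen : ∀ Cw, 0 ≤ Cw → Cw ≤ C0 → ∀ A, |A| ≤ Cw * (Φ + Φ * (C2 / ε ^ 2 * (ε ^ 2) ^ (2 - α)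
        + (ε ^ 2) ^ (-α) * Φ) + S) → ‖A‖ ≤ C0 * N * (3 + C2) * ‖V t‖ := by
      intro Cw h1 h2 A hA
      refine hA.trans ((mul_le_mul_of_nonneg_left q2 h1).trans ?_)
      calc Cw * (N * (3 + C2) * ‖V t‖) ≤ C0 * (N * (3 + C2) * ‖V t‖) := by gcongr
        _ = _ := by ring
    refine (pi_norm_le_iff_of_nonneg (by positivity)).2 fun i => ?_
    refine norm_prod_le_iff.2 ⟨?_, ?_⟩
    · refine gen Cψ hCψ0 (by linarith) _ ?_
      have := hCψ a (θ t) (hθc t) (hs t ht) (fun x => (hb t ht x).1) _ (fun x => (hb t ht x).2)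
        (hm t ht) (ε ^ 2) hεε (y t) (hyp t ht).1 (hyp t ht).2 i
      rw [← hy' t ht i] at this
      exact this
    · refine gen Cχ hCχ0 (by linarith) _ ?_
      have := hCχ a (θ t) (hθc t) (hs t ht) (fun x => (hb t ht x).1) _ (fun x => (hb t ht x).2)
        (hm t ht) (ε ^ 2) hεε (y t) (hyp t ht).1 (hyp t ht).2 i
      rw [← hy' t ht i] at this
      exact this
  have h00 : (0:ℝ) ∈ Set.Icc (0:ℝ) T := ⟨le_rfl, hT.le⟩
  have hai : ∀ i, a i ≤ M := fun i =>
    Finset.single_le_sum (fun j _ => (ha j).le) (Finset.mem_univ i)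
  have hV0 : ‖V 0‖ ≤ c * ε ^ 2 := by
    have hle : ∀ lam : ℝ, |lam| ≤ 1 → ∀ i, |lam| * (C1 * ε) ^ 2 * a i ≤ c * ε ^ 2 := by
      intro lam hl i
      have := ha i
      calc |lam| * (C1 * ε) ^ 2 * a i ≤ 1 * (C1 * ε) ^ 2 * M := by
            gcongr
            exact hai i
        _ = C1 ^ 2 * M * ε ^ 2 := by ring
        _ ≤ c * ε ^ 2 := by rw [hc]; nlinarith
    refine (pi_norm_le_iff_of_nonneg (by positivity)).2 fun i => ?_
    refine norm_prod_le_iff.2 ⟨?_, ?_⟩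
    · have := init_est hr hAψ a (y 0) (hyp 0 h00).1 g hgc hgs hg0 hgm hgp hC1ε i
      simp only [← hinit] at this
      exact this.trans (hle 1 (by simp) i)
    · have := init_est hr hAχ a (y 0) (hyp 0 h00).1 g hgc hgs hg0 hgm hgp hC1ε i
      simp only [← hinit] at this
      exact this.trans (hle 0 (by simp) i)
  have hmain : ∀ t ∈ Set.Icc (0:ℝ) T, ‖V t‖ ≤ c * ε ^ 2 * Real.exp (κ * t) := by
    have hB : ∀ t, HasDerivAt (fun t => c * ε ^ 2 * Real.exp (κ * t))
        (κ * (c * ε ^ 2 * Real.exp (κ * t))) t := by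
      intro t
      have h1 : HasDerivAt (fun t : ℝ => κ * t) κ t := by
        simpa using (hasDerivAt_id' t).const_mul κ
      exact (h1.exp.const_mul (c * ε ^ 2)).congr_deriv (by ring)
    intro t ht
    refine image_norm_le_of_norm_deriv_right_lt_deriv_boundary (f := V) (f' := V') (a := 0) (b := T)
      (fun t ht => (hVd t ht).continuousAt.continuousWithinAt)
      (fun t ht => (hVd t (Set.Ico_subset_Icc_self ht)).hasDerivWithinAt)
      (by simpa using hV0) hB (fun t ht hVt => ?_) ht
    have ht' := Set.Ico_subset_Icc_self ht
    have hBpos : 0 < c * ε ^ 2 * Real.exp (κ * t) := by positivity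
    have hEx : Real.exp (κ * t) ≤ Real.exp (κ * T) := by
      apply Real.exp_le_exp.2
      exact mul_le_mul_of_nonneg_left ht'.2 hκ0.le
    have h1 : ‖V t‖ ≤ Eb * ε ^ 2 := by
      rw [hVt, hEb]
      calc c * ε ^ 2 * Real.exp (κ * t) ≤ c * ε ^ 2 * Real.exp (κ * T) := by gcongr
        _ = _ := by ring
    have h2 := hVb t ht' h1
    rw [hVt] at h2
    have h3 : κ * (c * ε ^ 2 * Real.exp (κ * t)) = C0 * N * (3 + C2) * (c * ε ^ 2 * Real.exp (κ * t))
        + c * ε ^ 2 * Real.exp (κ * t) := by rw [hκ]; ring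
    linarith
  intro t ht
  have hfin : ‖V t‖ ≤ Eb * ε ^ 2 := by
    have hEx : Real.exp (κ * t) ≤ Real.exp (κ * T) := by
      apply Real.exp_le_exp.2
      exact mul_le_mul_of_nonneg_left ht.2 hκ0.le
    refine (hmain t ht).trans ?_
    calc c * ε ^ 2 * Real.exp (κ * t) ≤ c * ε ^ 2 * Real.exp (κ * T) := by gcongr
      _ = _ := by rw [hEb]; ring
  have hpp : 0 ≤ Eb * ε ^ 2 := by positivity
  have hN : (0:ℝ) ≤ N := by positivity
  refine ⟨fun i => (hV2 t i).trans (hfin.trans ?_), (hΦ t ht).trans ?_⟩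
  · have : 0 ≤ N * (Eb * ε ^ 2) := by positivity
    linarith
  · have : N * ‖V t‖ ≤ N * (Eb * ε ^ 2) := by gcongr
    linarith

lemma test_approx {N : ℕ} (T : ℝ) {r : ℝ} (hr : 0 < r) {χ : E2 → ℝ} (h : Cut r χ)
    (y : ℝ → Fin N → E2) (hyc : ∀ i, Continuous fun t => y t i)
    (hyp : ∀ t ∈ Set.Icc (0:ℝ) T, SepPts r (y t))
    (f : E2 → ℝ) (hf : Continuous f) (B : ℝ) (hB : ∀ p, |f p| ≤ B) (δ : ℝ) (hδ : 0 < δ) :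
    ∃ C : ℝ, 0 ≤ C ∧ ∀ t ∈ Set.Icc (0:ℝ) T, ∀ x,
      |f x - ∑ i, χ (x - y t i) * f (y t i)| ≤ δ + C * rho r χ (y t) x := by
  have hB0 : 0 ≤ B := (abs_nonneg _).trans (hB 0)
  have hcpt : IsCompact (⋃ i, (fun t => y t i) '' Set.Icc (0:ℝ) T) :=
    isCompact_iUnion fun i => isCompact_Icc.image (hyc i)
  have hu := hcpt.uniformContinuousAt_of_continuousAt f (fun a _ => hf.continuousAt)
    (Metric.dist_mem_uniformity hδ)
  obtain ⟨η, hη, hηs⟩ := Metric.mem_uniformity_dist.1 hu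
  set η0 := min η r with hη0
  have hη00 : 0 < η0 := lt_min hη hr
  refine ⟨(1 + N) * B / η0 ^ 2, by positivity, ?_⟩
  intro t ht x
  have hp := hyp t ht
  have hρ := (rho_bd hr h hp x).1
  by_cases hx : ∀ i, η0 ≤ ‖x - y t i‖
  · have h1 := rho_out hr h hp x hη00.le (by linarith [min_le_right η r]) hx
    have h2 : |f x - ∑ i, χ (x - y t i) * f (y t i)| ≤ (1 + N) * B := by
      refine (abs_sub _ _).trans ?_
      have : |∑ i, χ (x - y t i) * f (y t i)| ≤ N * B := by
        refine (Finset.abs_sum_le_sum_abs _ _).trans ?_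
        refine (Finset.sum_le_card_nsmul _ _ B fun i _ => ?_).trans (le_of_eq (by simp))
        rw [abs_mul, abs_of_nonneg (h.nonneg _)]
        calc χ (x - y t i) * |f (y t i)| ≤ 1 * B :=
              mul_le_mul (h.le_one _) (hB _) (abs_nonneg _) zero_le_one
          _ = B := one_mul B
      linarith [hB x]
    have h3 : (1 + N) * B ≤ (1 + N) * B / η0 ^ 2 * rho r χ (y t) x := by
      rw [div_mul_eq_mul_div, le_div_iff₀ (by positivity)]
      gcongr
    linarith
  · push Not at hx
    obtain ⟨i, hi⟩ := hx
    have hir : ‖x - y t i‖ ≤ r := (hi.le).trans (min_le_right _ _)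
    have hsum : ∑ j, χ (x - y t j) * f (y t j) = f (y t i) := by
      rw [Finset.sum_eq_single i]
      · rw [h.one _ hir, one_mul]
      · intro j _ hj
        rw [chi_other hr h hp (Ne.symm hj) (x := x) (by linarith), zero_mul]
      · simp
    rw [hsum]
    have hd : dist (y t i) x < η := by
      rw [dist_comm, dist_eq_norm]; exact hi.trans_le (min_le_left _ _)
    have := hηs hd (Set.mem_iUnion.2 ⟨i, t, ht, rfl⟩)
    simp only [Set.mem_setOf_eq] at this
    rw [dist_comm, Real.dist_eq] at this
    have : 0 ≤ (1 + N) * B / η0 ^ 2 * rho r χ (y t) x := by positivity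
    linarith

/-- localization of the inviscid mSQG flow (α ∈ (0,1)) around point
vortices of identical (positive) sign.  Given regularized initial data concentrated
near the initial vortex positions, classical solutions of the inviscid α-gSQG
equation converge weakly-* (uniformly in time on [0,T]) to the empirical measure of
the point vortex dynamics. -/
theorem msqg_localization
    (α : ℝ) (hα : α ∈ Set.Ioo (0:ℝ) 1)
    (N : ℕ) (T : ℝ) (hT : 0 < T)
    (a : Fin N → ℝ) (ha : ∀ i, 0 < a i)
    (x0 : Fin N → E2) (hx0 : ∀ i j : Fin N, i ≠ j → x0 i ≠ x0 j)
    (C1 C2 d : ℝ) (hC1 : 0 < C1) (hC2 : 0 < C2) (hd : 0 < d)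
    -- the regularized initial data
    (θ0 : ℝ → Fin N → E2 → ℝ)
    (hθ0_smooth : ∀ ε ∈ Set.Ioc (0:ℝ) 1, ∀ i,
      ContDiff ℝ (⊤ : ℕ∞) (θ0 ε i) ∧ HasCompactSupport (θ0 ε i))
    (hθ0_supp : ∀ ε ∈ Set.Ioc (0:ℝ) 1, ∀ i,
      tsupport (θ0 ε i) ⊆ Metric.closedBall (x0 i) (C1 * ε))
    (hθ0_sep : ∀ ε ∈ Set.Ioc (0:ℝ) 1, ∀ i j : Fin N, i ≠ j →
      ∀ p ∈ tsupport (θ0 ε i), ∀ q ∈ tsupport (θ0 ε j), d ≤ dist p q)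
    (hθ0_mass : ∀ ε ∈ Set.Ioc (0:ℝ) 1, ∀ i, (∫ p : E2, θ0 ε i p) = a i)
    (hθ0_bdd : ∀ ε ∈ Set.Ioc (0:ℝ) 1, ∀ i, ∀ p : E2,
      0 ≤ θ0 ε i p ∧ θ0 ε i p ≤ C2 / ε ^ 2)
    -- the solutions of the inviscid α-gSQG equation
    (θ : ℝ → ℝ → E2 → ℝ)
    (hθ_diff : ∀ ε ∈ Set.Ioc (0:ℝ) 1, ContDiff ℝ 1 (fun q : ℝ × E2 => θ ε q.1 q.2))
    (hθ_init : ∀ ε ∈ Set.Ioc (0:ℝ) 1, ∀ p : E2, θ ε 0 p = ∑ i : Fin N, θ0 ε i p)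
    (hθ_supp : ∀ ε ∈ Set.Ioc (0:ℝ) 1, ∀ t ∈ Set.Icc (0:ℝ) T, HasCompactSupport (θ ε t))
    (hθ_bdd : ∀ ε ∈ Set.Ioc (0:ℝ) 1, ∀ t ∈ Set.Icc (0:ℝ) T, ∀ p : E2,
      0 ≤ θ ε t p ∧ θ ε t p ≤ C2 / ε ^ 2)
    (hθ_mass : ∀ ε ∈ Set.Ioc (0:ℝ) 1, ∀ t ∈ Set.Icc (0:ℝ) T,
      (∫ p : E2, θ ε t p) = ∑ i : Fin N, a i)
    -- the transport equation ∂ₜθ + u·∇θ = 0 with u = K_α ∗ θ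
    (hPDE : ∀ ε ∈ Set.Ioc (0:ℝ) 1, ∀ t ∈ Set.Icc (0:ℝ) T, ∀ p : E2,
      deriv (fun s : ℝ => θ ε s p) t
        + ⟪(∫ y : E2, θ ε t y • K α (p - y) : E2), gradient (θ ε t) p⟫ = 0)
    -- the point vortex dynamics
    (x : ℝ → Fin N → E2) (hx : IsPVSol α a x0 T x)
    -- the test function
    (f : E2 → ℝ) (hf_cont : Continuous f) (hf_bdd : ∃ M : ℝ, ∀ p : E2, |f p| ≤ M) :
    ∀ δ > (0:ℝ), ∃ ε0 > (0:ℝ), ∀ ε : ℝ, 0 < ε → ε ≤ ε0 → ε ≤ 1 →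
      ∀ t ∈ Set.Icc (0:ℝ) T,
        |(∫ p : E2, θ ε t p * f p) - ∑ i : Fin N, a i * f (x t i)| ≤ δ := by
  intro δ hδ
  obtain ⟨hα0, hα1⟩ := hα
  obtain ⟨y, y', hy'c, hyd, hyx, hy'⟩ := vortex_ext α a x0 T hT x hx
  have hyc : ∀ i, Continuous fun t => y t i := fun i =>
    continuous_iff_continuousAt.2 fun t => (hyd i t).continuousAt
  have h00 : (0:ℝ) ∈ Set.Icc (0:ℝ) T := ⟨le_rfl, hT.le⟩
  have hy0 : ∀ i, y 0 i = x0 i := by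
    intro i
    rw [hyx 0 h00, hx.2.2 i 0 h00]
    simp
  obtain ⟨r, hr, R, hyp⟩ := sep_radius T y hyc (fun t ht i j hij => by
    rw [hyx t ht]; exact hx.2.1 t ht i j hij)
  obtain ⟨χ, h⟩ := exists_cut r hr
  obtain ⟨B, hB⟩ := hf_bdd
  have hB0 : 0 ≤ B := (abs_nonneg _).trans (hB 0)
  obtain ⟨C, hC0, ε1, hε1, hconc⟩ := concentration α hα0 hα1 N T hT a ha hr h y y' hy'c hyd hyp hy'
    C1 C2 hC1 hC2
  set M := ∑ i, a i with hM
  have hM0 : 0 ≤ M := Finset.sum_nonneg fun i _ => (ha i).le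
  set δ1 := δ / (2 * (M + 1)) with hδ1
  have hδ10 : 0 < δ1 := by positivity
  obtain ⟨C', hC'0, hC'⟩ := test_approx T hr h y hyc (fun t ht => (hyp t ht).1) f hf_cont B hB δ1 hδ10
  set Q := C' * C + N * (C * B) with hQ
  have hQ0 : 0 ≤ Q := by positivity
  refine ⟨min ε1 (δ / (2 * (Q + 1))), by positivity, ?_⟩
  intro ε hε0 hεm hε1' t ht
  have hε : ε ∈ Set.Ioc (0:ℝ) 1 := ⟨hε0, hε1'⟩
  obtain ⟨k1, k2⟩ := hconc ε hε0 (hεm.trans (min_le_left _ _)) hε1' (θ ε) (hθ_diff ε hε)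
    (hθ_supp ε hε) (hθ_bdd ε hε) (hθ_mass ε hε) (hPDE ε hε) (θ0 ε)
    (fun i => (hθ0_smooth ε hε i).1.continuous) (fun i => (hθ0_smooth ε hε i).2)
    (fun i x => (hθ0_bdd ε hε i x).1) (hθ0_mass ε hε)
    (fun i p hp => by
      have := hθ0_supp ε hε i (subset_tsupport _ hp)
      rw [hy0]
      simpa [dist_eq_norm] using this)
    (hθ_init ε hε) t ht
  have hθc : Continuous (θ ε t) :=
    (hθ_diff ε hε).continuous.comp (by fun_prop : Continuous fun z : E2 => (t, z))
  have hs := hθ_supp ε hε t ht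
  have hb := hθ_bdd ε hε t ht
  have hm := hθ_mass ε hε t ht
  have hχ := h.smooth.continuous
  have hρc := rho_cont h (y t)
  have hint : ∀ g : E2 → ℝ, Continuous g → Integrable (fun p => θ ε t p * g p) := fun g hg =>
    Continuous.integrable_of_hasCompactSupport (by fun_prop) hs.mul_right
  have hθi : Integrable (θ ε t) := hθc.integrable_of_hasCompactSupport hs
  have iχ : ∀ i, Integrable (fun p => θ ε t p * χ (p - y t i)) := fun i => hint _ (by fun_prop)
  have e0 : (∫ p, θ ε t p * (f p - ∑ i, χ (p - y t i) * f (y t i)))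
      = (∫ p, θ ε t p * f p) - ∑ i, (∫ p, θ ε t p * χ (p - y t i)) * f (y t i) := by
    have : ∀ p, θ ε t p * (f p - ∑ i, χ (p - y t i) * f (y t i))
        = θ ε t p * f p - ∑ i, (θ ε t p * χ (p - y t i)) * f (y t i) := by
      intro p
      rw [mul_sub, Finset.mul_sum]
      congr 1
      exact Finset.sum_congr rfl fun i _ => by ring
    simp only [this]
    rw [integral_sub (hint f hf_cont) (integrable_finsetSum _ fun i _ => (iχ i).mul_const _),
      integral_finsetSum _ (fun i _ => (iχ i).mul_const _)]
    simp only [integral_mul_const]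
  have e1 : (∫ p, θ ε t p * f p) - ∑ i, a i * f (x t i)
      = (∫ p, θ ε t p * (f p - ∑ i, χ (p - y t i) * f (y t i)))
        + ∑ i, ((∫ p, θ ε t p * χ (p - y t i)) - a i) * f (y t i) := by
    rw [e0, ← hyx t ht]
    simp only [sub_mul, Finset.sum_sub_distrib]
    ring
  have b1 : |∫ p, θ ε t p * (f p - ∑ i, χ (p - y t i) * f (y t i))| ≤ δ1 * M + C' * (C * ε ^ 2) := by
    have : ‖∫ p, θ ε t p * (f p - ∑ i, χ (p - y t i) * f (y t i))‖
        ≤ ∫ p, (δ1 * θ ε t p + C' * (θ ε t p * rho r χ (y t) p)) := by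
      refine norm_integral_le_of_norm_le ((hθi.const_mul _).add ((hint _ hρc).const_mul _))
        (Filter.Eventually.of_forall fun p => ?_)
      rw [norm_mul, Real.norm_eq_abs, Real.norm_eq_abs, abs_of_nonneg (hb p).1]
      refine (mul_le_mul_of_nonneg_left (hC' t ht p) (hb p).1).trans (le_of_eq (by ring))
    rw [integral_add (hθi.const_mul _) ((hint _ hρc).const_mul _), integral_const_mul,
      integral_const_mul, hm] at this
    refine this.trans ?_
    gcongr
  have b2 : |∑ i, ((∫ p, θ ε t p * χ (p - y t i)) - a i) * f (y t i)| ≤ N * (C * ε ^ 2 * B) := by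
    refine (Finset.abs_sum_le_sum_abs _ _).trans ?_
    refine (Finset.sum_le_card_nsmul _ _ (C * ε ^ 2 * B) fun i _ => ?_).trans (le_of_eq (by simp))
    rw [abs_mul]
    exact mul_le_mul (k1 i) (hB _) (abs_nonneg _) (by positivity)
  have b3 : δ1 * M ≤ δ / 2 := by
    rw [hδ1, div_mul_eq_mul_div, div_le_div_iff₀ (by positivity) (by positivity)]
    nlinarith
  have b4 : Q * ε ^ 2 ≤ δ / 2 := by
    have h1 : ε ≤ δ / (2 * (Q + 1)) := hεm.trans (min_le_right _ _)
    rw [le_div_iff₀ (by positivity)] at h1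
    have h2 : ε ^ 2 ≤ ε := by nlinarith
    have h3 : Q * ε ^ 2 ≤ Q * ε := by gcongr
    linarith
  rw [e1]
  refine (abs_add_le _ _).trans ?_
  have b5 : Q * ε ^ 2 = C' * (C * ε ^ 2) + N * (C * ε ^ 2 * B) := by rw [hQ]; ring
  linarith
end
end

section
/- Let n ≥ 1 and s ∈ (0,n). There exists a constant C = C(n,s) > 0 such that for every measurable function f : ℝⁿ → ℝ belonging to L¹(ℝⁿ) ∩ L^∞(ℝⁿ) and every x ∈ ℝⁿ, ∫_{ℝⁿ} |f(y)|/|x − y|^{n−s} dy ≤ C ‖f‖_{L¹}^{s/n} ‖f‖_{L^∞}^{(n−s)/n}. -/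
open MeasureTheory

lemma riesz_aux_int (n : ℕ) (hn : 1 ≤ n) (a : ℝ) (ha : a < n) (r : ℝ) :
    IntegrableOn (fun z : EuclideanSpace ℝ (Fin n) => ‖z‖ ^ (-a)) (Metric.ball 0 r) := by
  refine integrableOn_ball_of_norm_le_rpow (C := 1) (α := a) (by simpa using hn) (by simpa using ha)
    ?_ ?_
  · refine Filter.Eventually.of_forall fun z => ?_
    rw [one_mul, Real.norm_of_nonneg (by positivity)]
  · exact (measurable_norm.pow_const _).aestronglyMeasurable

lemma riesz_aux_scale (n : ℕ) (s R : ℝ) (hR : 0 < R) :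
    ∫ z in Metric.ball (0 : EuclideanSpace ℝ (Fin n)) R, ‖z‖ ^ (-((n : ℝ) - s)) =
      R ^ s * ∫ z in Metric.ball (0 : EuclideanSpace ℝ (Fin n)) 1, ‖z‖ ^ (-((n : ℝ) - s)) := by
  have h := Measure.setIntegral_comp_smul_of_pos volume
    (fun z : EuclideanSpace ℝ (Fin n) => ‖z‖ ^ (-((n : ℝ) - s))) (Metric.ball 0 1) hR
  rw [smul_unitBall_of_pos hR] at h
  simp only [norm_smul, Real.norm_of_nonneg hR.le, finrank_euclideanSpace, Fintype.card_fin,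
    smul_eq_mul] at h
  simp_rw [Real.mul_rpow hR.le (norm_nonneg _)] at h
  rw [integral_const_mul] at h
  have hp : (0:ℝ) < R ^ n := by positivity
  have h2 : R ^ s = R ^ n * R ^ (-((n : ℝ) - s)) := by
    rw [← Real.rpow_natCast, ← Real.rpow_add hR]; congr 1; ring
  rw [h2, mul_assoc, h]
  field_simp

/-- L¹–L^∞ bound for the Riesz potential of order s on ℝⁿ:
∫ |f(y)|/|x−y|^{n−s} dy ≤ C ‖f‖_{L¹}^{s/n} ‖f‖_{L^∞}^{(n−s)/n}. -/
theorem riesz_potential_Linfty_bound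
    (n : ℕ) (hn : 1 ≤ n) (s : ℝ) (hs : s ∈ Set.Ioo (0:ℝ) n) :
    ∃ C > (0:ℝ), ∀ f : EuclideanSpace ℝ (Fin n) → ℝ,
      Integrable f → MemLp f ⊤ volume →
      ∀ x : EuclideanSpace ℝ (Fin n),
        ∫⁻ y, ENNReal.ofReal (|f y| / ‖x - y‖ ^ ((n : ℝ) - s)) ≤
          ENNReal.ofReal (C * (∫ y, |f y|) ^ (s / n) *
            ((eLpNorm f ⊤ volume).toReal) ^ (((n : ℝ) - s) / n)) := by
  obtain ⟨hs0, hsn⟩ := hs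
  have hn0 : (0:ℝ) < n := hs0.trans hsn
  set B := ∫ z in Metric.ball (0 : EuclideanSpace ℝ (Fin n)) 1, ‖z‖ ^ (-((n : ℝ) - s)) with hB
  have hB0 : 0 ≤ B := integral_nonneg fun z => by positivity
  refine ⟨B + 1, by linarith, fun f hf hf' x => ?_⟩
  set M := (eLpNorm f ⊤ volume).toReal with hM
  set L := ∫ y, |f y| with hL
  have hL0 : 0 ≤ L := integral_nonneg fun y => abs_nonneg _
  have hM0 : 0 ≤ M := ENNReal.toReal_nonneg
  have hae : ∀ᵐ y, |f y| ≤ M := by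
    have h := ae_le_eLpNormEssSup (f := f) (μ := volume)
    filter_upwards [h] with y hy
    rw [← eLpNorm_exponent_top] at hy
    have := ENNReal.toReal_mono hf'.2.ne hy
    simpa [hM] using this
  by_cases hz : f =ᵐ[volume] 0
  · have : ∫⁻ y, ENNReal.ofReal (|f y| / ‖x - y‖ ^ ((n : ℝ) - s)) = ∫⁻ y : EuclideanSpace ℝ (Fin n), 0 := by
      refine lintegral_congr_ae ?_
      filter_upwards [hz] with y hy
      simp [hy]
    rw [this]; simp
  have hLp : 0 < L := by
    refine lt_of_le_of_ne hL0 fun h => hz ?_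
    have := (integral_eq_zero_iff_of_nonneg (fun y => abs_nonneg (f y)) hf.abs).1 h.symm
    filter_upwards [this] with y hy
    simpa using hy
  have hMp : 0 < M := by
    refine lt_of_le_of_ne hM0 fun h => hz ?_
    filter_upwards [hae] with y hy
    rw [← h] at hy
    simpa using hy
  set R := (L / M) ^ (1 / (n:ℝ)) with hRdef
  have hR : 0 < R := by positivity
  set k : EuclideanSpace ℝ (Fin n) → ℝ :=
    (Metric.ball 0 R).indicator (fun z => ‖z‖ ^ (-((n : ℝ) - s))) with hk
  have hkint : Integrable k :=
    (integrable_indicator_iff measurableSet_ball).2 (riesz_aux_int n hn _ (by linarith) R)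
  have hkval : ∫ z, k z = R ^ s * B := by
    rw [hk, integral_indicator measurableSet_ball, riesz_aux_scale n s R hR]
  have hk0 : ∀ z, 0 ≤ k z := fun z => Set.indicator_nonneg (fun z _ => by positivity) z
  have hkx : Integrable (fun y => k (x - y)) := hkint.comp_sub_left x
  set g : EuclideanSpace ℝ (Fin n) → ℝ :=
    fun y => M * k (x - y) + R ^ (-((n : ℝ) - s)) * |f y| with hg
  have hgint : Integrable g := (hkx.const_mul M).add (hf.abs.const_mul _)
  have hg0 : ∀ y, 0 ≤ g y := fun y => by
    have := hk0 (x - y)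
    positivity
  have hgval : ∫ y, g y = M * (R ^ s * B) + R ^ (-((n : ℝ) - s)) * L := by
    rw [hg, integral_add (hkx.const_mul M) (hf.abs.const_mul _), integral_const_mul,
      integral_const_mul, integral_sub_left_eq_self k volume x, hkval]
  calc ∫⁻ y, ENNReal.ofReal (|f y| / ‖x - y‖ ^ ((n : ℝ) - s))
      ≤ ∫⁻ y, ENNReal.ofReal (g y) := by
        refine lintegral_mono_ae ?_
        filter_upwards [hae] with y hy
        refine ENNReal.ofReal_le_ofReal ?_
        rw [div_eq_mul_inv, ← Real.rpow_neg (norm_nonneg _)]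
        by_cases hxy : x - y ∈ Metric.ball (0 : EuclideanSpace ℝ (Fin n)) R
        · have e : k (x - y) = ‖x - y‖ ^ (-((n : ℝ) - s)) := Set.indicator_of_mem hxy _
          simp only [hg, e]
          have h1 : |f y| * ‖x - y‖ ^ (-((n : ℝ) - s)) ≤ M * ‖x - y‖ ^ (-((n : ℝ) - s)) := by
            gcongr
          have h2 : 0 ≤ R ^ (-((n : ℝ) - s)) * |f y| := by positivity
          linarith
        · have e : k (x - y) = 0 := Set.indicator_of_notMem hxy _
          simp only [hg, e, mul_zero, zero_add]
          rw [mul_comm]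
          have hle : R ≤ ‖x - y‖ := by simpa using hxy
          exact mul_le_mul_of_nonneg_right
            (Real.rpow_le_rpow_of_nonpos hR hle (by linarith)) (abs_nonneg _)
    _ = ENNReal.ofReal (∫ y, g y) :=
        (ofReal_integral_eq_lintegral_ofReal hgint (Filter.Eventually.of_forall hg0)).symm
    _ = _ := by
        congr 1
        rw [hgval]
        have e1 : M * R ^ s = L ^ (s / n) * M ^ (((n : ℝ) - s) / n) := by
          rw [hRdef, ← Real.rpow_mul (by positivity), Real.div_rpow hL0 hM0,
            show ((n : ℝ) - s) / n = 1 - 1 / n * s by field_simp, Real.rpow_sub hMp,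
            Real.rpow_one, show 1 / (n:ℝ) * s = s / n by ring]
          ring
        have e2 : R ^ (-((n : ℝ) - s)) * L = M * R ^ s := by
          have : R ^ (n:ℝ) = L / M := by
            rw [hRdef, ← Real.rpow_mul (by positivity), one_div_mul_cancel hn0.ne', Real.rpow_one]
          rw [neg_sub, Real.rpow_sub hR, this]
          field_simp
        rw [e2, ← mul_assoc, e1]
        ring
end

section
/- Let f : ℝ² → ℝ be a Schwartz function with ∫_{ℝ²} f(x) dx = 0. Then lim_{α → 0⁺} C_α ∫_{ℝ²} |x|^{−α} f(x) dx = −(1/(2π)) ∫_{ℝ²} ln|x| f(x) dx, where C_α = Γ(α/2)/(2^{2−α} π Γ((2−α)/2)). -/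
open MeasureTheory Filter
noncomputable section

theorem gfl_bound {r a : ℝ} (hr : 0 < r) (ha : 0 < a) (ha2 : a < 1 / 2) :
    |(r ^ (-a) - 1) / a| ≤ 4 * (r⁻¹ + r) := by
  have hE : r ^ (-a) = Real.exp (-(a * Real.log r)) := by
    rw [Real.rpow_def_of_pos hr]; ring_nf
  have h1 := Real.add_one_le_exp (-(a * Real.log r))
  have hrp : 0 < r ^ (-a) := Real.rpow_pos_of_pos hr _
  have hri : 0 < r⁻¹ := inv_pos.mpr hr
  rw [abs_div, abs_of_pos ha, div_le_iff₀ ha]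
  rcases le_total 1 r with h | h
  · have hl : 0 ≤ Real.log r := Real.log_nonneg h
    have hl2 : Real.log r ≤ r := (Real.log_le_sub_one_of_pos hr).trans (by linarith)
    have : r ^ (-a) ≤ 1 := Real.rpow_le_one_of_one_le_of_nonpos h (by linarith)
    rw [abs_of_nonpos (by linarith)]
    rw [← hE] at h1
    nlinarith [mul_le_mul_of_nonneg_left hl2 ha.le, mul_pos ha hri, mul_pos ha hr]
  · have hl : Real.log r ≤ 0 := Real.log_nonpos hr.le h
    have h1' : 1 ≤ r ^ (-a) := Real.one_le_rpow_of_pos_of_le_one_of_nonpos hr h (by linarith)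
    rw [abs_of_nonneg (by linarith)]
    have h2 := Real.add_one_le_exp (a * Real.log r)
    have h3 : r ^ (-a) * Real.exp (a * Real.log r) = 1 := by
      rw [hE, ← Real.exp_add]; simp
    have h4 : r ^ (-a) - 1 ≤ a * (-Real.log r) * r ^ (-a) := by nlinarith
    have h5 : r ^ (-a) ≤ r ^ (-(1/2) : ℝ) :=
      Real.rpow_le_rpow_of_exponent_ge hr h (by linarith)
    have h6 := Real.abs_log_mul_self_rpow_lt r (1/2) hr h (by norm_num)
    have hs : 0 < r ^ (1/2 : ℝ) := Real.rpow_pos_of_pos hr _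
    have hsn : 0 < r ^ (-(1/2) : ℝ) := Real.rpow_pos_of_pos hr _
    have h7 : r ^ (1/2 : ℝ) * r ^ (-(1/2) : ℝ) = 1 := by
      rw [← Real.rpow_add hr]; simp
    have h8 : r ^ (-(1/2) : ℝ) * r ^ (-(1/2) : ℝ) = r⁻¹ := by
      rw [← Real.rpow_add hr, ← Real.rpow_neg_one]; norm_num
    have h9 : -Real.log r ≤ 2 * r ^ (-(1/2) : ℝ) := by
      have : -Real.log r * r ^ (1/2 : ℝ) ≤ 2 := by
        have := (abs_lt.mp h6).1
        norm_num at this ⊢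
        linarith
      calc -Real.log r = (-Real.log r * r ^ (1/2 : ℝ)) * r ^ (-(1/2) : ℝ) := by
            rw [mul_assoc, h7, mul_one]
        _ ≤ _ := mul_le_mul_of_nonneg_right this hsn.le
    have h10 : (-Real.log r) * r ^ (-a) ≤ (2 * r ^ (-(1/2) : ℝ)) * r ^ (-(1/2) : ℝ) :=
      mul_le_mul h9 h5 hrp.le (by positivity)
    rw [mul_assoc, h8] at h10
    nlinarith [mul_le_mul_of_nonneg_left h10 ha.le, mul_pos ha hri, mul_pos ha hr]

theorem gfl_int (f : SchwartzMap E2 ℝ) :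
    Integrable (fun x : E2 => 4 * (‖x‖⁻¹ + ‖x‖) * ‖f x‖) := by
  have h1 : Integrable (fun x : E2 => ‖x‖ * ‖f x‖) := by
    simpa using f.integrable_pow_mul volume 1
  have hball : IntegrableOn (fun x : E2 => ‖x‖⁻¹) (Metric.ball (0 : E2) 1) := by
    refine (integrableOn_fun_norm_addHaar (volume : Measure E2) (f := fun y : ℝ => y⁻¹)).2 ?_
    have : IntegrableOn (fun _ : ℝ => (1 : ℝ)) (Set.Ioo 0 1) := by simp
    refine this.congr_fun ?_ measurableSet_Ioo
    intro y hy
    have : y ≠ 0 := hy.1.ne'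
    simp [this]
  have hind := (integrable_indicator_iff (μ := volume)
    (Metric.isOpen_ball (x := (0 : E2)) (ε := 1)).measurableSet).2 hball
  have h2 : Integrable (fun x : E2 => ‖x‖⁻¹ * ‖f x‖) := by
    refine ((hind.const_mul (SchwartzMap.seminorm ℝ 0 0 f)).add f.integrable.norm).mono'
      ?_ (Eventually.of_forall fun x => ?_)
    · have := f.continuous
      exact ((measurable_norm.inv).mul this.measurable.norm).aestronglyMeasurable
    · have hb := SchwartzMap.norm_le_seminorm ℝ f x
      have hn := norm_nonneg (f x)
      rw [Real.norm_of_nonneg (by positivity)]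
      simp only [Pi.add_apply, Set.indicator, mem_ball_zero_iff]
      split_ifs with h
      · have : 0 ≤ ‖x‖⁻¹ := by positivity
        nlinarith
      · have : ‖x‖⁻¹ ≤ 1 := inv_le_one_of_one_le₀ (not_lt.mp h)
        nlinarith
  refine ((h2.add h1).const_mul 4).congr (Eventually.of_forall fun x => ?_)
  simp only [Pi.add_apply]; ring

theorem gfl_const : Tendsto (fun a : ℝ => a * Cconst a) (nhdsWithin 0 (Set.Ioi 0))
    (nhds (1 / (2 * Real.pi))) := by
  have hc : ContinuousAt (fun a : ℝ => 2 * Real.Gamma (a / 2 + 1) /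
      (2 ^ ((2:ℝ) - a) * Real.pi * Real.Gamma ((2 - a) / 2))) 0 := by
    have hG : ContinuousAt Real.Gamma 1 :=
      (Real.differentiableAt_Gamma (s := 1) (fun m => by
        have : (0:ℝ) ≤ m := m.cast_nonneg
        intro h; linarith)).continuousAt
    have g1 : ContinuousAt (fun a : ℝ => Real.Gamma (a / 2 + 1)) 0 :=
      ContinuousAt.comp (g := Real.Gamma) (x := (0:ℝ)) (f := fun a : ℝ => a / 2 + 1) (by simpa using hG) (by fun_prop)
    have g2 : ContinuousAt (fun a : ℝ => Real.Gamma ((2 - a) / 2)) 0 :=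
      ContinuousAt.comp (g := Real.Gamma) (x := (0:ℝ)) (f := fun a : ℝ => (2 - a) / 2) (by simpa using hG) (by fun_prop)
    have g3 : ContinuousAt (fun a : ℝ => (2:ℝ) ^ ((2:ℝ) - a)) 0 :=
      ContinuousAt.rpow continuousAt_const (by fun_prop) (by left; norm_num)
    refine (continuousAt_const.mul g1).div ((g3.mul continuousAt_const).mul g2) ?_
    simp [Real.pi_ne_zero]
  have ht := hc.tendsto.mono_left (nhdsWithin_le_nhds (s := Set.Ioi 0))
  have e : 2 * Real.Gamma ((0:ℝ) / 2 + 1) /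
      (2 ^ ((2:ℝ) - 0) * Real.pi * Real.Gamma ((2 - 0) / 2)) = 1 / (2 * Real.pi) := by
    have := Real.pi_ne_zero
    norm_num
    field_simp
    norm_num
  rw [e] at ht
  refine ht.congr' ?_
  filter_upwards [self_mem_nhdsWithin] with a ha
  have ha : (0:ℝ) < a := ha
  rw [Real.Gamma_add_one (by positivity), Cconst]
  ring

theorem gfl_dct (f : SchwartzMap E2 ℝ) :
    Tendsto (fun a : ℝ => ∫ x : E2, (‖x‖ ^ (-a) - 1) / a * f x) (nhdsWithin 0 (Set.Ioi 0))
      (nhds (∫ x : E2, -Real.log ‖x‖ * f x)) := by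
  have hne : ∀ᵐ x : E2, x ≠ 0 := by simp [ae_iff]
  refine tendsto_integral_filter_of_dominated_convergence _ ?_ ?_ (gfl_int f) ?_
  · refine Eventually.of_forall fun a => ?_
    have := f.continuous.measurable
    exact Measurable.aestronglyMeasurable (by fun_prop)
  · filter_upwards [Ioo_mem_nhdsGT (show (0:ℝ) < 1/2 by norm_num)] with a ha
    filter_upwards [hne] with x hx
    rw [norm_mul]
    exact mul_le_mul_of_nonneg_right (gfl_bound (norm_pos_iff.mpr hx) ha.1 ha.2) (norm_nonneg _)
  · filter_upwards [hne] with x hx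
    refine Tendsto.mul_const _ ?_
    have hr := norm_pos_iff.mpr hx
    have hd : HasDerivAt (fun a : ℝ => ‖x‖ ^ (-a)) (-Real.log ‖x‖) 0 := by
      have := (hasDerivAt_neg (0:ℝ)).const_rpow hr
      simpa using this
    have := (hasDerivAt_iff_tendsto_slope.1 hd).mono_left
      (nhdsWithin_mono 0 (fun a (ha : 0 < a) => ha.ne'))
    refine this.congr fun a => ?_
    simp [slope_def_field]

/-- for a mean-zero Schwartz function f on ℝ²,
C_α ∫ |x|^{−α} f(x) dx → −(1/(2π)) ∫ ln|x| f(x) dx as α → 0⁺. -/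
theorem green_function_limit
    (f : SchwartzMap E2 ℝ) (hf : ∫ x, f x = 0) :
    Tendsto (fun α : ℝ => Cconst α * ∫ x : E2, ‖x‖ ^ (-α) * f x)
      (nhdsWithin 0 (Set.Ioi 0))
      (nhds (-(1 / (2 * Real.pi)) * ∫ x : E2, Real.log ‖x‖ * f x)) := by
  have h := gfl_const.mul (gfl_dct f)
  have e : (1 / (2 * Real.pi)) * ∫ x : E2, -Real.log ‖x‖ * f x
      = -(1 / (2 * Real.pi)) * ∫ x : E2, Real.log ‖x‖ * f x := by
    simp only [neg_mul, integral_neg, mul_neg]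
  rw [e] at h
  refine h.congr' ?_
  filter_upwards [Ioo_mem_nhdsGT (show (0:ℝ) < 1/2 by norm_num)] with a ha
  have ha0 : a ≠ 0 := ha.1.ne'
  have hne : ∀ᵐ x : E2, x ≠ 0 := by simp [ae_iff]
  have hi : Integrable (fun x : E2 => (‖x‖ ^ (-a) - 1) / a * f x) := by
    refine (gfl_int f).mono' ?_ ?_
    · have := f.continuous.measurable
      exact Measurable.aestronglyMeasurable (by fun_prop)
    · filter_upwards [hne] with x hx
      rw [norm_mul]
      exact mul_le_mul_of_nonneg_right (gfl_bound (norm_pos_iff.mpr hx) ha.1 ha.2) (norm_nonneg _)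
  have : ∫ x : E2, ‖x‖ ^ (-a) * f x = a * ∫ x : E2, (‖x‖ ^ (-a) - 1) / a * f x := by
    have e2 : (fun x : E2 => ‖x‖ ^ (-a) * f x)
        = fun x => a * ((‖x‖ ^ (-a) - 1) / a * f x) + f x := by
      funext x; field_simp; ring
    rw [e2, integral_add (hi.const_mul a) f.integrable, hf, integral_const_mul, add_zero]
  rw [this]; ring
end
end

section
/- Let α ∈ (0,2), N ∈ ℕ, let a₁,…,a_N > 0 all be positive, and let x⁰ = (x₁⁰,…,x_N⁰) consist of pairwise distinct points of ℝ². Then for every T > 0 there exists a (necessarily unique) solution of the α-point-vortex model on [0,T] with intensities a and initial configuration x⁰. In other words, the point vortex system with identically signed intensities has a unique global solution. -/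
open MeasureTheory Finset
noncomputable section

def perpL : E2 →ₗ[ℝ] E2 where
  toFun := perp
  map_add' x y := by
    ext i; fin_cases i <;> simp [perp] <;> ring
  map_smul' c x := by
    ext i; fin_cases i <;> simp [perp]

lemma perpL_apply (z : E2) : perpL z = perp z := rfl

lemma norm_perpL (z : E2) : ‖perpL z‖ = ‖z‖ := by
  simp [perpL_apply, perp, EuclideanSpace.norm_eq, Fin.sum_univ_two, add_comm]

lemma inner_perpL (z : E2) : inner ℝ z (perpL z) = 0 := by
  simp [perpL_apply, perp, PiLp.inner_apply, Fin.sum_univ_two]; ring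

/-- regularised radial profile -/
def Qr (β ρ r : ℝ) : ℝ := (max r ρ) ^ (-β)

/-- regularised radial field -/
def Fr (β ρ : ℝ) (z : E2) : E2 := Qr β ρ ‖z‖ • z

lemma Qr_pos {β ρ : ℝ} (hρ : 0 < ρ) (r : ℝ) : 0 < Qr β ρ r :=
  Real.rpow_pos_of_pos (lt_max_of_lt_right hρ) _

lemma Qr_le {β ρ : ℝ} (hβ : 0 < β) (hρ : 0 < ρ) (r : ℝ) : Qr β ρ r ≤ ρ ^ (-β) :=
  Real.rpow_le_rpow_of_nonpos hρ (le_max_right _ _) (by linarith)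

lemma Qr_anti {β ρ : ℝ} (hβ : 0 < β) (hρ : 0 < ρ) {r s : ℝ} (h : r ≤ s) :
    Qr β ρ s ≤ Qr β ρ r :=
  Real.rpow_le_rpow_of_nonpos (lt_max_of_lt_right hρ) (max_le_max_right _ h) (by linarith)

lemma Qr_continuous {β ρ : ℝ} (hρ : 0 < ρ) : Continuous (Qr β ρ) := by
  unfold Qr
  refine Continuous.rpow_const (by fun_prop) (fun x => Or.inl ?_)
  exact (lt_max_of_lt_right hρ).ne'

lemma Qr_tangent {β ρ : ℝ} (hβ : 0 < β) (hρ : 0 < ρ) {r s : ℝ} (h0 : 0 ≤ r) (h : r ≤ s) :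
    (Qr β ρ r - Qr β ρ s) * r ≤ β * ρ ^ (-β) * (s - r) := by
  have hr' : 0 < max r ρ := lt_max_of_lt_right hρ
  have hs' : 0 < max s ρ := lt_max_of_lt_right hρ
  have h1 : (Qr β ρ r - Qr β ρ s) * r ≤ (Qr β ρ r - Qr β ρ s) * max r ρ :=
    mul_le_mul_of_nonneg_left (le_max_left _ _) (sub_nonneg.2 (Qr_anti hβ hρ h))
  set u := max r ρ with hu
  set v := max s ρ with hv
  have huv : v - u ≤ s - r := by
    rw [hu, hv]
    rcases le_total s ρ with h2 | h2
    · rw [max_eq_right h2, max_eq_right (h.trans h2)]; linarith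
    · rw [max_eq_left h2]; linarith [le_max_left r ρ]
  have h3 : 1 - β * (v / u - 1) ≤ (v / u) ^ (-β) := by
    rw [Real.rpow_def_of_pos (by positivity)]
    have e1 := Real.add_one_le_exp (Real.log (v / u) * -β)
    have e2 := Real.log_le_sub_one_of_pos (show 0 < v / u by positivity)
    nlinarith
  have h4 : v ^ (-β) = u ^ (-β) * (v / u) ^ (-β) := by
    rw [← Real.mul_rpow hr'.le (by positivity)]; congr 1; field_simp
  have hup : 0 < u ^ (-β) := Real.rpow_pos_of_pos hr' _
  have h5 : (Qr β ρ r - Qr β ρ s) * u ≤ u ^ (-β) * β * (v - u) := by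
    have : Qr β ρ r - Qr β ρ s = u ^ (-β) * (1 - (v / u) ^ (-β)) := by
      simp only [Qr, ← hu, ← hv]; rw [h4]; ring
    rw [this]
    have : (1 - (v / u) ^ (-β)) * u ≤ β * (v - u) := by
      calc (1 - (v / u) ^ (-β)) * u ≤ (β * (v / u - 1)) * u := by
            apply mul_le_mul_of_nonneg_right _ hr'.le; linarith
        _ = β * (v - u) := by field_simp
    calc _ = u ^ (-β) * ((1 - (v / u) ^ (-β)) * u) := by ring
      _ ≤ u ^ (-β) * (β * (v - u)) := by gcongr
      _ = _ := by ring
  have h6 : u ^ (-β) ≤ ρ ^ (-β) := Qr_le hβ hρ r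
  have h7 : 0 ≤ v - u := sub_nonneg.2 (max_le_max_right _ h)
  have h8 : 0 < ρ ^ (-β) := Real.rpow_pos_of_pos hρ _
  calc _ ≤ u ^ (-β) * β * (v - u) := h1.trans h5
    _ ≤ ρ ^ (-β) * β * (s - r) := by gcongr
    _ = _ := by ring

lemma Fr_lip_aux {β ρ : ℝ} (hβ : 0 < β) (hρ : 0 < ρ) (z w : E2) (h : ‖z‖ ≤ ‖w‖) :
    ‖Fr β ρ z - Fr β ρ w‖ ≤ (1 + β) * ρ ^ (-β) * ‖z - w‖ := by
  have e : Fr β ρ z - Fr β ρ w =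
      Qr β ρ ‖w‖ • (z - w) + (Qr β ρ ‖z‖ - Qr β ρ ‖w‖) • z := by
    simp only [Fr]; module
  rw [e]
  refine (norm_add_le _ _).trans ?_
  rw [norm_smul, norm_smul, Real.norm_of_nonneg (Qr_pos hρ _).le,
    Real.norm_of_nonneg (sub_nonneg.2 (Qr_anti hβ hρ h))]
  have h1 := Qr_tangent hβ hρ (norm_nonneg z) h
  have h2 := Qr_le hβ hρ ‖w‖
  have h3 : ‖w‖ - ‖z‖ ≤ ‖z - w‖ := by
    rw [norm_sub_rev]; exact norm_sub_norm_le _ _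
  have h8 : 0 < ρ ^ (-β) := Real.rpow_pos_of_pos hρ _
  have h4 : Qr β ρ ‖w‖ * ‖z - w‖ ≤ ρ ^ (-β) * ‖z - w‖ := by gcongr
  have h5 : β * ρ ^ (-β) * (‖w‖ - ‖z‖) ≤ β * ρ ^ (-β) * ‖z - w‖ := by gcongr
  linarith

lemma Fr_lip {β ρ : ℝ} (hβ : 0 < β) (hρ : 0 < ρ) (z w : E2) :
    ‖Fr β ρ z - Fr β ρ w‖ ≤ (1 + β) * ρ ^ (-β) * ‖z - w‖ := by
  rcases le_total ‖z‖ ‖w‖ with h | h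
  · exact Fr_lip_aux hβ hρ z w h
  · rw [norm_sub_rev, norm_sub_rev z]; exact Fr_lip_aux hβ hρ w z h

lemma Fr_bdd {β ρ : ℝ} (hβ : 1 < β) (hρ : 0 < ρ) (z : E2) :
    ‖Fr β ρ z‖ ≤ ρ ^ (1 - β) := by
  have hm : 0 < max ‖z‖ ρ := lt_max_of_lt_right hρ
  rw [Fr, norm_smul, Real.norm_of_nonneg (Qr_pos hρ _).le]
  calc Qr β ρ ‖z‖ * ‖z‖ ≤ Qr β ρ ‖z‖ * max ‖z‖ ρ :=
        mul_le_mul_of_nonneg_left (le_max_left _ _) (Qr_pos hρ _).le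
    _ = (max ‖z‖ ρ) ^ (1 - β) := by
        rw [Qr, sub_eq_neg_add, Real.rpow_add hm, Real.rpow_one]
    _ ≤ _ := Real.rpow_le_rpow_of_nonpos hρ (le_max_right _ _) (by linarith)

lemma Fr_zero (β ρ : ℝ) : Fr β ρ 0 = 0 := by simp [Fr]

lemma Fr_neg (β ρ : ℝ) (z w : E2) : Fr β ρ (z - w) = - Fr β ρ (w - z) := by
  rw [Fr, Fr, norm_sub_rev, ← smul_neg, neg_sub]

/-- regularised vector field -/
def Vr (c β ρ : ℝ) {N : ℕ} (a : Fin N → ℝ) (x : Fin N → E2) : Fin N → E2 :=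
  fun i => c • perpL (∑ j, a j • Fr β ρ (x i - x j))

lemma Vr_lip {c β ρ : ℝ} (hβ : 0 < β) (hρ : 0 < ρ) {N : ℕ} (a : Fin N → ℝ) :
    ∃ L : NNReal, LipschitzWith L (Vr c β ρ a) := by
  have h8 : 0 < ρ ^ (-β) := Real.rpow_pos_of_pos hρ _
  have hL : 0 ≤ |c| * ∑ j, |a j| * ((1 + β) * ρ ^ (-β) * 2) := by positivity
  refine ⟨Real.toNNReal (|c| * ∑ j, |a j| * ((1 + β) * ρ ^ (-β) * 2)), LipschitzWith.of_dist_le_mul fun x y => ?_⟩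
  rw [Real.coe_toNNReal _ hL, dist_eq_norm, dist_eq_norm]
  refine (pi_norm_le_iff_of_nonneg (by positivity)).2 fun i => ?_
  simp only [Pi.sub_apply, Vr, ← smul_sub, ← map_sub, ← Finset.sum_sub_distrib]
  rw [norm_smul, norm_perpL, Real.norm_eq_abs, mul_assoc]
  refine mul_le_mul_of_nonneg_left ?_ (abs_nonneg _)
  refine (norm_sum_le _ _).trans ?_
  rw [Finset.sum_mul]
  refine Finset.sum_le_sum fun j _ => ?_
  rw [norm_smul, Real.norm_eq_abs, mul_assoc]
  refine mul_le_mul_of_nonneg_left ?_ (abs_nonneg _)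
  refine (Fr_lip hβ hρ _ _).trans ?_
  rw [mul_assoc _ 2]
  refine mul_le_mul_of_nonneg_left ?_ (by positivity)
  have e : x i - x j - (y i - y j) = (x - y) i - (x - y) j := by
    simp only [Pi.sub_apply]; abel
  rw [e]
  have h1 := norm_le_pi_norm (x - y) i
  have h2 := norm_le_pi_norm (x - y) j
  linarith [norm_sub_le ((x - y) i) ((x - y) j)]

lemma Vr_bdd {c β ρ : ℝ} (hβ : 1 < β) (hρ : 0 < ρ) {N : ℕ} (a : Fin N → ℝ) :
    ∃ L : NNReal, ∀ x, ‖Vr c β ρ a x‖ ≤ L := by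
  have h8 : 0 < ρ ^ (1 - β) := Real.rpow_pos_of_pos hρ _
  have hL : 0 ≤ |c| * ∑ j, |a j| * ρ ^ (1 - β) := by positivity
  refine ⟨Real.toNNReal (|c| * ∑ j, |a j| * ρ ^ (1 - β)), fun x => ?_⟩
  rw [Real.coe_toNNReal _ hL]
  refine (pi_norm_le_iff_of_nonneg (by positivity)).2 fun i => ?_
  simp only [Vr]
  rw [norm_smul, norm_perpL, Real.norm_eq_abs]
  refine mul_le_mul_of_nonneg_left ?_ (abs_nonneg _)
  refine (norm_sum_le _ _).trans ?_
  refine Finset.sum_le_sum fun j _ => ?_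
  rw [norm_smul, Real.norm_eq_abs]
  exact mul_le_mul_of_nonneg_left (Fr_bdd hβ hρ _) (abs_nonneg _)

/-- regularised potential -/
def gr (α ρ s : ℝ) : ℝ :=
  ρ ^ (-α) - (α / 2) * ∫ u in (ρ ^ 2)..s, Qr (α + 2) ρ (√u)

lemma gr_deriv {α ρ : ℝ} (hρ : 0 < ρ) (s : ℝ) :
    HasDerivAt (gr α ρ) (- ((α / 2) * Qr (α + 2) ρ (√s))) s := by
  have hc : Continuous fun u => Qr (α + 2) ρ (√u) :=
    (Qr_continuous hρ).comp Real.continuous_sqrt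
  have := (hc.integral_hasStrictDerivAt (ρ ^ 2) s).hasDerivAt
  exact (this.const_mul (α / 2)).const_sub _

lemma gr_small {α ρ : ℝ} (hα : 0 < α) (hρ : 0 < ρ) {s : ℝ} (h : s ≤ ρ ^ 2) :
    ρ ^ (-α) ≤ gr α ρ s := by
  have : 0 ≤ ∫ u in s..(ρ ^ 2), Qr (α + 2) ρ (√u) :=
    intervalIntegral.integral_nonneg h fun u _ => (Qr_pos hρ _).le
  rw [gr, intervalIntegral.integral_symm]
  nlinarith

lemma gr_large {α ρ : ℝ} (hα : 0 < α) (hρ : 0 < ρ) {r : ℝ} (h : ρ ≤ r) :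
    gr α ρ (r ^ 2) = r ^ (-α) := by
  have hr := hρ.trans_le h
  have h2 : ρ ^ 2 ≤ r ^ 2 := by gcongr
  have e : ∫ u in (ρ ^ 2)..(r ^ 2), Qr (α + 2) ρ (√u) =
      ∫ u in (ρ ^ 2)..(r ^ 2), u ^ (-(α + 2) / 2) := by
    refine intervalIntegral.integral_congr fun u hu => ?_
    rw [Set.uIcc_of_le h2] at hu
    have hu0 : 0 ≤ u := (sq_nonneg ρ).trans hu.1
    have : ρ ≤ √u := Real.le_sqrt_of_sq_le hu.1
    simp only [Qr]
    rw [max_eq_left this, Real.sqrt_eq_rpow, ← Real.rpow_mul hu0]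
    congr 1; ring
  rw [gr, e, integral_rpow]
  · have hk : ∀ t : ℝ, 0 < t → (t ^ 2) ^ (-(α + 2) / 2 + 1) = t ^ (-α) := by
      intro t ht
      rw [← Real.rpow_natCast, ← Real.rpow_mul ht.le]; congr 1; push_cast; ring
    rw [hk r hr, hk ρ hρ]
    have : -(α + 2) / 2 + 1 = -(α / 2) := by ring
    rw [this]; field_simp; ring
  · right
    refine ⟨by linarith, ?_⟩
    rw [Set.uIcc_of_le h2]
    intro h0
    have := h0.1
    have : 0 < ρ ^ 2 := by positivity
    linarith

lemma gr_pos {α ρ : ℝ} (hα : 0 < α) (hρ : 0 < ρ) {r : ℝ} (h : 0 ≤ r) :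
    0 < gr α ρ (r ^ 2) := by
  rcases le_total ρ r with h1 | h1
  · rw [gr_large hα hρ h1]; exact Real.rpow_pos_of_pos (hρ.trans_le h1) _
  · exact (Real.rpow_pos_of_pos hρ _).trans_le (gr_small hα hρ (by gcongr))

lemma energy_zero (c : ℝ) {N : ℕ} (a : Fin N → ℝ) (F : Fin N → Fin N → E2)
    (hF : ∀ i j, F i j = - F j i) (V : Fin N → E2)
    (hV : ∀ i, V i = c • perpL (∑ j, a j • F i j)) :
    ∑ i, ∑ j, a i * a j * inner ℝ (F i j) (V i - V j) = 0 := by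
  have h1 : ∑ i, ∑ j, a i * a j * inner ℝ (F i j) (V i) = 0 := by
    refine Finset.sum_eq_zero fun i _ => ?_
    have : ∑ j, a i * a j * inner ℝ (F i j) (V i) =
        a i * inner ℝ (∑ j, a j • F i j) (V i) := by
      rw [sum_inner, Finset.mul_sum]
      refine Finset.sum_congr rfl fun j _ => ?_
      rw [real_inner_smul_left]; ring
    rw [this, hV i, real_inner_smul_right, inner_perpL]; simp
  have h2 : ∑ i, ∑ j, a i * a j * inner ℝ (F i j) (V j) = 0 := by
    rw [Finset.sum_comm, ← neg_eq_zero, ← h1, ← Finset.sum_neg_distrib]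
    refine Finset.sum_congr rfl fun i _ => ?_
    rw [← Finset.sum_neg_distrib]
    refine Finset.sum_congr rfl fun j _ => ?_
    rw [hF i j, inner_neg_left]; ring
  simp only [inner_sub_right, mul_sub, Finset.sum_sub_distrib, h1, h2, sub_zero]

lemma K_eq {α ρ : ℝ} (hρ : 0 < ρ) {z : E2} (hz : ρ ≤ ‖z‖) :
    K α z = (-(α * Cconst α)) • perpL (Fr (α + 2) ρ z) := by
  rw [K, Fr, Qr, max_eq_left hz, map_smul, smul_smul, Real.rpow_neg (norm_nonneg _),
    perpL_apply, div_eq_mul_inv]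

lemma Vr_int {α ρ T : ℝ} (hα : 0 < α) (hρ : 0 < ρ) {N : ℕ} (a : Fin N → ℝ)
    (x : ℝ → Fin N → E2) (hx : ContinuousOn x (Set.Icc 0 T))
    (hsep : ∀ t ∈ Set.Icc 0 T, ∀ i j : Fin N, i ≠ j → ρ ≤ ‖x t i - x t j‖)
    {t : ℝ} (ht : t ∈ Set.Icc 0 T) (i : Fin N) :
    (∫ s in (0:ℝ)..t, Vr (-(α * Cconst α)) (α + 2) ρ a (x s)) i =
      ∑ j ∈ Finset.univ.erase i, a j • (∫ s in (0:ℝ)..t, K α (x s i - x s j)) := by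
  have hsub : Set.uIcc 0 t ⊆ Set.Icc 0 T := by
    rw [Set.uIcc_of_le ht.1]; exact Set.Icc_subset_Icc_right ht.2
  have hxt : ContinuousOn x (Set.uIcc 0 t) := hx.mono hsub
  obtain ⟨L, hL⟩ := Vr_lip (c := -(α * Cconst α)) (β := α + 2) (by linarith) hρ a
  have hVi : IntervalIntegrable (fun s => Vr (-(α * Cconst α)) (α + 2) ρ a (x s)) volume 0 t :=
    (hL.continuous.comp_continuousOn hxt).intervalIntegrable
  have hFc : Continuous (Fr (α + 2) ρ) := by
    unfold Fr
    exact ((Qr_continuous hρ).comp continuous_norm).smul continuous_id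
  have hPc : Continuous perpL := perpL.continuous_of_finiteDimensional
  have hxi : ∀ k, ContinuousOn (fun s => x s k) (Set.uIcc 0 t) := fun k =>
    (continuous_apply k).comp_continuousOn hxt
  have hKF : ∀ j ≠ i, ∀ s ∈ Set.uIcc 0 t, K α (x s i - x s j) =
      (-(α * Cconst α)) • perpL (Fr (α + 2) ρ (x s i - x s j)) := fun j hj s hs =>
    K_eq hρ (hsep s (hsub hs) i j hj.symm)
  have h1 := (ContinuousLinearMap.proj (R := ℝ) (φ := fun _ : Fin N => E2)
    i).intervalIntegral_comp_comm hVi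
  simp only [ContinuousLinearMap.proj_apply] at h1
  rw [← h1]
  have h2 : ∀ s, Vr (-(α * Cconst α)) (α + 2) ρ a (x s) i = ∑ j ∈ Finset.univ.erase i,
      a j • ((-(α * Cconst α)) • perpL (Fr (α + 2) ρ (x s i - x s j))) := by
    intro s
    rw [Vr, map_sum, Finset.smul_sum, ← Finset.add_sum_erase _ _ (Finset.mem_univ i)]
    simp only [sub_self, Fr_zero, smul_zero, map_zero, zero_add, map_smul]
    exact Finset.sum_congr rfl fun j _ => smul_comm _ _ _
  simp only [h2]
  rw [intervalIntegral.integral_finsetSum]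
  · refine Finset.sum_congr rfl fun j hj => ?_
    rw [intervalIntegral.integral_smul]
    congr 1
    exact intervalIntegral.integral_congr fun s hs => (hKF j (Finset.ne_of_mem_erase hj) s hs).symm
  · intro j _
    apply ContinuousOn.intervalIntegrable
    have hc : ContinuousOn (fun s => perpL (Fr (α + 2) ρ (x s i - x s j))) (Set.uIcc 0 t) :=
      (hPc.comp hFc).comp_continuousOn ((hxi i).sub (hxi j))
    exact (hc.const_smul (-(α * Cconst α))).const_smul (a j)

lemma sep_event {T : ℝ} {N : ℕ} (x : ℝ → Fin N → E2)
    (hx : ContinuousOn x (Set.Icc 0 T))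
    (hne : ∀ t ∈ Set.Icc 0 T, ∀ i j : Fin N, i ≠ j → x t i ≠ x t j) :
    ∀ᶠ ρ in nhdsWithin (0:ℝ) (Set.Ioi 0), ∀ i j : Fin N, i ≠ j →
      ∀ t ∈ Set.Icc 0 T, ρ ≤ ‖x t i - x t j‖ := by
  rw [Filter.eventually_all]; intro i
  rw [Filter.eventually_all]; intro j
  by_cases hij : i = j
  · exact Filter.Eventually.of_forall fun _ h => absurd hij h
  rcases (Set.Icc 0 T).eq_empty_or_nonempty with he | he
  · exact Filter.Eventually.of_forall fun _ h t ht => by simp [he] at ht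
  have hc : ContinuousOn (fun t => ‖x t i - x t j‖) (Set.Icc 0 T) :=
    (((continuous_apply i).comp_continuousOn hx).sub
      ((continuous_apply j).comp_continuousOn hx)).norm
  obtain ⟨t0, ht0, hmin⟩ := isCompact_Icc.exists_isMinOn he hc
  have hpos : 0 < ‖x t0 i - x t0 j‖ := norm_pos_iff.2 (sub_ne_zero.2 (hne t0 ht0 i j hij))
  filter_upwards [mem_nhdsWithin_of_mem_nhds (Iic_mem_nhds hpos)] with ρ hρ _ t ht
  exact le_trans hρ (hmin ht)

lemma sol_deriv {α ρ T : ℝ} (hα : 0 < α) (hρ : 0 < ρ) {N : ℕ} (a : Fin N → ℝ)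
    (x0 : Fin N → E2) (x : ℝ → Fin N → E2) (h : IsPVSol α a x0 T x)
    (hsep : ∀ i j : Fin N, i ≠ j → ∀ t ∈ Set.Icc 0 T, ρ ≤ ‖x t i - x t j‖) :
    ∀ t ∈ Set.Ico 0 T,
      HasDerivWithinAt x (Vr (-(α * Cconst α)) (α + 2) ρ a (x t)) (Set.Ici t) t := by
  intro t ht
  obtain ⟨hx, hne, heq⟩ := h
  have hT : 0 ≤ T := ht.1.trans ht.2.le
  obtain ⟨L, hL⟩ := Vr_lip (c := -(α * Cconst α)) (β := α + 2) (by linarith) hρ a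
  have key : ∀ s ∈ Set.Icc 0 T, x s =
      ODE.picard (fun _ => Vr (-(α * Cconst α)) (α + 2) ρ a) 0 x0 x s := by
    intro s hs
    funext i
    rw [ODE.picard_apply, Pi.add_apply,
      Vr_int hα hρ a x hx (fun t ht i j hij => hsep i j hij t ht) hs i]
    exact heq i s hs
  have h1 := ODE.hasDerivWithinAt_picard_Icc (f := fun _ => Vr (-(α * Cconst α)) (α + 2) ρ a)
    (u := Set.univ) (Set.left_mem_Icc.2 hT)
    ((hL.continuous.comp continuous_snd).continuousOn) hx (fun _ _ => trivial) x0
    (Set.Ico_subset_Icc_self ht)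
  have h2 := h1.congr_of_mem key (Set.Ico_subset_Icc_self ht)
  refine h2.mono_of_mem_nhdsWithin ?_
  exact mem_nhdsWithin.2 ⟨Set.Iio T, isOpen_Iio, ht.2, fun s hs =>
    ⟨ht.1.trans hs.2, le_of_lt hs.1⟩⟩

lemma exists_reg {c β ρ T : ℝ} (hβ : 1 < β) (hρ : 0 < ρ) (hT : 0 < T) {N : ℕ} (a : Fin N → ℝ)
    (x0 : Fin N → E2) :
    ∃ x : ℝ → Fin N → E2, x 0 = x0 ∧ ∀ t ∈ Set.Icc 0 T,
      HasDerivWithinAt x (Vr c β ρ a (x t)) (Set.Icc 0 T) t := by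
  obtain ⟨L, hL⟩ := Vr_lip (c := c) (β := β) (by linarith) hρ a
  obtain ⟨M, hM⟩ := Vr_bdd (c := c) hβ hρ a
  have hp : IsPicardLindelof (fun _ => Vr c β ρ a) (⟨0, Set.left_mem_Icc.2 hT.le⟩ : Set.Icc 0 T)
      x0 (M * T.toNNReal) 0 M L := by
    refine IsPicardLindelof.of_time_independent (fun x _ => hM x) hL.lipschitzOnWith ?_
    simp [hT.le]
  exact hp.exists_eq_forall_mem_Icc_hasDerivWithinAt₀

lemma energy_cons {c α ρ T : ℝ} (hρ : 0 < ρ) {N : ℕ} (a : Fin N → ℝ)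
    (x : ℝ → Fin N → E2) (hd : ∀ t ∈ Set.Icc 0 T,
      HasDerivWithinAt x (Vr c (α + 2) ρ a (x t)) (Set.Icc 0 T) t) :
    ∀ t ∈ Set.Icc 0 T, ∑ i, ∑ j, a i * a j * gr α ρ (‖x t i - x t j‖ ^ 2) =
      ∑ i, ∑ j, a i * a j * gr α ρ (‖x 0 i - x 0 j‖ ^ 2) := by
  have hD : ∀ t ∈ Set.Icc 0 T, HasDerivWithinAt
      (fun t => ∑ i, ∑ j, a i * a j * gr α ρ (‖x t i - x t j‖ ^ 2)) 0 (Set.Icc 0 T) t := by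
    intro t ht
    set V := Vr c (α + 2) ρ a (x t) with hV
    have hi : ∀ i, HasDerivWithinAt (fun t => x t i) (V i) (Set.Icc 0 T) t :=
      hasDerivWithinAt_pi.1 (hd t ht)
    have hij : ∀ i j, HasDerivWithinAt (fun t => a i * a j * gr α ρ (‖x t i - x t j‖ ^ 2))
        (-α * (a i * a j * inner ℝ (Fr (α + 2) ρ (x t i - x t j)) (V i - V j)))
        (Set.Icc 0 T) t := by
      intro i j
      have h1 := ((hi i).fun_sub (hi j)).norm_sq
      have h2 := ((gr_deriv (α := α) hρ (‖x t i - x t j‖ ^ 2)).comp_hasDerivWithinAt t h1).const_mul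
        (a i * a j)
      refine h2.congr_deriv ?_
      rw [Real.sqrt_sq (norm_nonneg _), Fr, real_inner_smul_left]
      ring
    have := HasDerivWithinAt.fun_sum (u := Finset.univ) fun i _ =>
      HasDerivWithinAt.fun_sum (u := Finset.univ) fun j _ => hij i j
    refine this.congr_deriv ?_
    simp only [← Finset.mul_sum]
    rw [energy_zero c a (fun i j => Fr (α + 2) ρ (x t i - x t j)) (fun i j => Fr_neg _ _ _ _) V
      (fun i => rfl), mul_zero]
  refine constant_of_has_deriv_right_zero (fun t ht => (hD t ht).continuousWithinAt) ?_
  intro t ht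
  refine (hD t (Set.Ico_subset_Icc_self ht)).mono_of_mem_nhdsWithin ?_
  exact mem_nhdsWithin.2 ⟨Set.Iio T, isOpen_Iio, ht.2, fun s hs =>
    ⟨ht.1.trans hs.2, le_of_lt hs.1⟩⟩

lemma off_diag {N : ℕ} (a : Fin N → ℝ) (g : ℝ → ℝ) (y : Fin N → E2) :
    ∑ i, ∑ j, a i * a j * g (‖y i - y j‖ ^ 2) =
      ∑ i, a i * a i * g 0 +
        ∑ i, ∑ j ∈ Finset.univ.erase i, a i * a j * g (‖y i - y j‖ ^ 2) := by
  rw [← Finset.sum_add_distrib]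
  refine Finset.sum_congr rfl fun i _ => ?_
  rw [← Finset.add_sum_erase _ _ (Finset.mem_univ i)]
  simp

/-- global existence and uniqueness for identically signed intensities. -/
theorem pv_global_existence_same_sign
    (α : ℝ) (hα : α ∈ Set.Ioo (0:ℝ) 2)
    (N : ℕ) (a : Fin N → ℝ) (ha : ∀ i, 0 < a i)
    (x0 : Fin N → E2) (hx0 : ∀ i j : Fin N, i ≠ j → x0 i ≠ x0 j) :
    ∀ T > (0:ℝ),
      (∃ x : ℝ → Fin N → E2, IsPVSol α a x0 T x) ∧
      (∀ x y : ℝ → Fin N → E2, IsPVSol α a x0 T x → IsPVSol α a x0 T y →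
        ∀ t ∈ Set.Icc (0:ℝ) T, x t = y t) := by
  intro T hT
  have hα0 : 0 < α := hα.1
  have h0T : (0:ℝ) ∈ Set.Icc 0 T := Set.left_mem_Icc.2 hT.le
  constructor
  · -- choice of the regularisation parameter
    set H := ∑ i, ∑ j ∈ Finset.univ.erase i, a i * a j * ‖x0 i - x0 j‖ ^ (-α) with hH
    have ev1 := sep_event (T := T) (fun _ => x0) continuousOn_const (fun _ _ => hx0)
    have ev2 : ∀ᶠ ρ in nhdsWithin (0:ℝ) (Set.Ioi 0), ∀ i j : Fin N,
        H < a i * a j * ρ ^ (-α) := by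
      rw [Filter.eventually_all]; intro i
      rw [Filter.eventually_all]; intro j
      have := (tendsto_rpow_neg_nhdsGT_zero (y := -α) (by linarith)).const_mul_atTop
        (mul_pos (ha i) (ha j))
      exact this.eventually_gt_atTop H
    obtain ⟨ρ, ⟨h1, h2⟩, hρ⟩ := ((ev1.and ev2).and self_mem_nhdsWithin).exists
    replace hρ : 0 < ρ := hρ
    obtain ⟨x, hx0', hd⟩ := exists_reg (c := -(α * Cconst α)) (β := α + 2) (by linarith) hρ hT a x0
    have hxc : ContinuousOn x (Set.Icc 0 T) := fun t ht => (hd t ht).continuousWithinAt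
    have hsep : ∀ t ∈ Set.Icc 0 T, ∀ i j : Fin N, i ≠ j → ρ ≤ ‖x t i - x t j‖ := by
      intro t ht i j hij
      by_contra! hlt
      have hE := energy_cons hρ a x hd t ht
      rw [off_diag, off_diag a _ (x 0), hx0'] at hE
      have hE2 := add_left_cancel hE
      have hH' : ∑ i, ∑ j ∈ Finset.univ.erase i, a i * a j * gr α ρ (‖x0 i - x0 j‖ ^ 2) = H := by
        refine Finset.sum_congr rfl fun i _ => Finset.sum_congr rfl fun j hj => ?_
        rw [gr_large hα0 hρ (h1 i j (Finset.ne_of_mem_erase hj).symm 0 h0T)]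
      rw [hH'] at hE2
      have hnn : ∀ i j, 0 ≤ a i * a j * gr α ρ (‖x t i - x t j‖ ^ 2) := fun i j =>
        mul_nonneg (mul_pos (ha i) (ha j)).le (gr_pos hα0 hρ (norm_nonneg _)).le
      have l1 : a i * a j * gr α ρ (‖x t i - x t j‖ ^ 2) ≤
          ∑ j ∈ Finset.univ.erase i, a i * a j * gr α ρ (‖x t i - x t j‖ ^ 2) :=
        Finset.single_le_sum (f := fun j => a i * a j * gr α ρ (‖x t i - x t j‖ ^ 2))
          (fun j _ => hnn i j) (Finset.mem_erase.2 ⟨hij.symm, Finset.mem_univ _⟩)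
      have l2 : ∑ j ∈ Finset.univ.erase i, a i * a j * gr α ρ (‖x t i - x t j‖ ^ 2) ≤
          ∑ i, ∑ j ∈ Finset.univ.erase i, a i * a j * gr α ρ (‖x t i - x t j‖ ^ 2) :=
        Finset.single_le_sum
          (f := fun i => ∑ j ∈ Finset.univ.erase i, a i * a j * gr α ρ (‖x t i - x t j‖ ^ 2))
          (fun i _ => Finset.sum_nonneg fun j _ => hnn i j) (Finset.mem_univ i)
      have l3 : a i * a j * ρ ^ (-α) ≤ a i * a j * gr α ρ (‖x t i - x t j‖ ^ 2) := by
        refine mul_le_mul_of_nonneg_left (gr_small hα0 hρ ?_) (mul_pos (ha i) (ha j)).le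
        gcongr
      have := h2 i j
      linarith
    obtain ⟨L, hL⟩ := Vr_lip (c := -(α * Cconst α)) (β := α + 2) (by linarith) hρ a
    refine ⟨x, hxc, ?_, ?_⟩
    · intro t ht i j hij he
      have := hsep t ht i j hij
      rw [he, sub_self, norm_zero] at this
      linarith
    · intro i t ht
      have hsub : Set.uIcc 0 t ⊆ Set.Icc 0 T := by
        rw [Set.uIcc_of_le ht.1]; exact Set.Icc_subset_Icc_right ht.2
      have := ODE.picard_eq_of_hasDerivAt (t₀ := 0) (t := t) (α := x)
        (f := fun _ => Vr (-(α * Cconst α)) (α + 2) ρ a)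
        (u := Set.univ) ((hL.continuous.comp continuous_snd).continuousOn)
        (fun s hs => (hd s (hsub hs)).mono hsub) (fun _ _ => trivial)
      rw [← this, ODE.picard_apply, Pi.add_apply, Vr_int hα0 hρ a x hxc hsep ht i, hx0']
  · intro x y hx hy
    obtain ⟨ρ, ⟨h1, h2⟩, hρ⟩ := (((sep_event x hx.1 hx.2.1).and (sep_event y hy.1 hy.2.1)).and
      self_mem_nhdsWithin).exists
    replace hρ : 0 < ρ := hρ
    obtain ⟨L, hL⟩ := Vr_lip (c := -(α * Cconst α)) (β := α + 2) (by linarith) hρ a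
    have hini : x 0 = y 0 := by
      funext i
      rw [hx.2.2 i 0 h0T, hy.2.2 i 0 h0T]; simp
    exact ODE_solution_unique (v := fun _ => Vr (-(α * Cconst α)) (α + 2) ρ a) (fun _ => hL)
      hx.1 (sol_deriv hα0 hρ a x0 x hx h1) hy.1 (sol_deriv hα0 hρ a x0 y hy h2) hini
end
end
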